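/- In any finite execution of the multi-writer auditable register implementation (Algorithm 1), the AUDIT operations are complete: if an AUDIT operation aop returns the set A, and a READ operation rop by process p_j returning value v precedes aop in the linearization λ, then the pair (j, v) is in A. -/

import Mathlib

/-!
# An operational model of Algorithm 1 (multi-writer auditable register)

The algorithm implements an `n`-writer `m`-reader auditable register from an
unbounded array `SLR[-1,0,1,...]` of `(m+n)`-sliding registers, a max register
`M` storing a triple `(widx, ridx, auditset)` (ordered by its first field,
modelled here as an atomic object), and an array `H[1..m]` of single-writer
registers.  Each line of the pseudo-code is a step; readers, writers and
auditors are modelled by explicit program counters, and executions are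
alternating sequences of configurations and labelled steps starting from the
initial configuration.
-/

namespace Alg1

/-- Values stored in the auditable register. -/
abbrev Val := ℕ

/-- Entries of the sliding registers: `w`-tuples `(w, j, v, h)` posted by
    writers (with `h` a helping set of readers) and reader identifiers. -/
inductive Entry (m n : ℕ) where
  | w (j : Fin n) (v : Val) (h : Finset (Fin m))
  | r (i : Fin m)

variable {m n : ℕ}

def Entry.isW : Entry m n → Bool
  | .w _ _ _ => true
  | .r _ => false

/-- Does the window contain a `w`-tuple? -/
def hasW (win : List (Entry m n)) : Bool := win.any Entry.isW

/-- The first `w`-tuple in a window, if any. -/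
def firstW : List (Entry m n) → Option (Fin n × Val × Finset (Fin m))
  | [] => none
  | .w j v h :: _ => some (j, v, h)
  | .r _ :: rest => firstW rest

/-- `getValue`: the value of the first `w`-tuple of a window (default `0`). -/
def wval (win : List (Entry m n)) : Val := ((firstW win).map fun t => t.2.1).getD 0

/-- Reader identifiers that precede every `w`-tuple of a window. -/
def preW : List (Entry m n) → Finset (Fin m)
  | [] => ∅
  | .w _ _ _ :: _ => ∅
  | .r i :: rest => insert i (preW rest)

/-- `READERS(win)`: readers preceding every `w`-tuple, together with the
    helping set of the first `w`-tuple, if any. -/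
def readersOf (win : List (Entry m n)) : Finset (Fin m) :=
  preW win ∪ ((firstW win).map fun t => t.2.2).getD ∅

/-- Content of the max register `M`: a triple `(widx, ridx, auditset)`,
    ordered by the first field. -/
structure MVal (m : ℕ) where
  widx : ℤ
  ridx : Fin m → ℤ
  aud : Finset (Fin m × Val)

/-- Semantics of `writeMax` on `M`. -/
def wmax (old new : MVal m) : MVal m := if old.widx < new.widx then new else old

/-- The triple written to `M` after reading window `win` from `SLR[x]`:
    `(x+1, ridx[j ∈ READERS(win)] := x, auditset ∪ {(j, lv) : j ∈ READERS(win)})`. -/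
def mArg (mc : MVal m) (win : List (Entry m n)) (x : ℤ) (lv : Val) : MVal m where
  widx := x + 1
  ridx := fun j => if j ∈ readersOf win then x else mc.ridx j
  aud := mc.aud ∪ (readersOf win).image fun j => (j, lv)

/-- Write to a `k`-sliding register: append, keeping the last `k` entries. -/
def slide (k : ℕ) (l : List (Entry m n)) (e : Entry m n) : List (Entry m n) :=
  let l' := l ++ [e]
  l'.drop (l'.length - k)

/-- Program counter of a reader (one state per line of the pseudo-code). -/
inductive RPC where
  | idle
  | precheck   -- read `SLR[lsr]` (line `rd_last_wd`)
  | preM       -- read `M` (line `new_write`)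
  | preHelp    -- `writeMax` on `M` (line `rd_help_M1`)
  | loopM      -- read `M` at the head of the repeat loop (line `rd_M`)
  | helpVal    -- found help: read `SLR[lsr-1]` (`getValue`, line `rd_return_help`)
  | annH       -- write `H[i] := lsr` (line `rd_annouce_att`)
  | wSLR       -- write `i` to `SLR[lsr]` (line `rd_do_att`)
  | rSLR       -- read `SLR[lsr]` (line `rd_do_att`)
  | gVal       -- read `SLR[lsr-1]` (`getValue`, line `rd_val`)
  | helpChk    -- help the pending write to complete (line `rd_help_M2`)
  | loopEnd    -- evaluate the until condition (line `rd_att_success`)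
  | retNow     -- return `lval`

structure RState (m n : ℕ) where
  lsr : ℤ
  lval : Val
  mc : MVal m
  win : List (Entry m n)
  it : ℕ          -- number of iterations of the repeat loop of the current READ
  pc : RPC

/-- Program counter of a writer. -/
inductive WPC where
  | idle
  | readM    -- read `M` (line `w_read_M`)
  | scanH    -- read `H[k]` (line `w_att`)
  | scanS    -- read `SLR[a_k]` (line `w_help_wd`)
  | post     -- write the `w`-tuple to `SLR[widx]` (line `w_write_SLR`)
  | postR    -- read `SLR[widx]`
  | postV    -- read `SLR[widx-1]` (`getValue`)
  | postM    -- `writeMax` on `M` (line `w_write_M`)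
  | wret     -- return

structure WState (m n : ℕ) where
  v : Val
  mc : MVal m
  toHelp : Finset (Fin m)
  k : ℕ
  a : ℤ
  win : List (Entry m n)
  val : Val
  pc : WPC

/-- Program counter of an auditor. -/
inductive APC where
  | idle
  | aM       -- read `M` (line `adt_read_M`)
  | aR       -- read `SLR[widx]` (line `adt_val`)
  | aV       -- read `SLR[widx-1]` (`getValue`, line `adt_val`)
  | aret     -- return the audit set

structure AState (m n : ℕ) where
  mc : MVal m
  win : List (Entry m n)
  val : Val
  pc : APC

/-- Processes: `m` readers, `n` writers, and arbitrarily many auditors. -/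
inductive Proc (m n : ℕ) where
  | rdr (i : Fin m)
  | wtr (j : Fin n)
  | adt (a : ℕ)
  deriving DecidableEq

/-- A configuration: shared memory plus the local state of every process. -/
structure Config (m n : ℕ) where
  slr : ℤ → List (Entry m n)
  M : MVal m
  H : Fin m → ℤ
  rst : Fin m → RState m n
  wst : Fin n → WState m n
  ast : ℕ → AState m n

/-- Step labels: invocations and responses of high-level operations, and
    primitive operations applied to the base objects. -/
inductive Lbl (m n : ℕ) where
  | invRead (i : Fin m)
  | respRead (i : Fin m) (v : Val)
  | invWrite (j : Fin n) (v : Val)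
  | respWrite (j : Fin n)
  | invAudit (a : ℕ)
  | respAudit (a : ℕ) (A : Finset (Fin m × Val))
  | slrRead (p : Proc m n) (x : ℤ) (win : List (Entry m n))
  | slrWrite (p : Proc m n) (x : ℤ) (e : Entry m n)
  | mRead (p : Proc m n) (v : MVal m)
  | mWrite (p : Proc m n) (v : MVal m)
  | hRead (j : Fin n) (k : Fin m) (a : ℤ)
  | hWrite (i : Fin m) (x : ℤ)
  | tau (p : Proc m n)

def upR (c : Config m n) (i : Fin m) (s : RState m n) : Config m n :=
  { c with rst := Function.update c.rst i s }

def upW (c : Config m n) (j : Fin n) (s : WState m n) : Config m n :=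
  { c with wst := Function.update c.wst j s }

def upA (c : Config m n) (a : ℕ) (s : AState m n) : Config m n :=
  { c with ast := Function.update c.ast a s }

/-- The transition relation of Algorithm 1. -/
def Step (c : Config m n) (l : Lbl m n) (c' : Config m n) : Prop :=
  match l with
  | .invRead i =>
      let s := c.rst i
      s.pc = .idle ∧
      c' = upR c i { s with it := 0, pc := if 0 ≤ s.lsr then RPC.precheck else RPC.loopM }
  | .respRead i v =>
      let s := c.rst i
      s.pc = .retNow ∧ v = s.lval ∧ c' = upR c i { s with pc := .idle }
  | .invWrite j v =>
      let s := c.wst j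
      s.pc = .idle ∧ c' = upW c j { s with v := v, pc := .readM }
  | .respWrite j =>
      let s := c.wst j
      s.pc = .wret ∧ c' = upW c j { s with pc := .idle }
  | .invAudit a =>
      let s := c.ast a
      s.pc = .idle ∧ c' = upA c a { s with pc := .aM }
  | .respAudit a A =>
      let s := c.ast a
      s.pc = .aret ∧
      A = s.mc.aud ∪ (readersOf s.win).image (fun j => (j, s.val)) ∧
      c' = upA c a { s with pc := .idle }
  | .slrRead p x win =>
      win = c.slr x ∧
      (match p with
       | .rdr i =>
          let s := c.rst i
          (s.pc = .precheck ∧ x = s.lsr ∧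
             c' = upR c i { s with win := win, pc := if hasW win then RPC.preM else RPC.retNow }) ∨
          (s.pc = .helpVal ∧ x = s.lsr - 1 ∧
             c' = upR c i { s with lval := wval win, pc := .retNow }) ∨
          (s.pc = .rSLR ∧ x = s.lsr ∧
             c' = upR c i { s with win := win, pc := .gVal }) ∨
          (s.pc = .gVal ∧ x = s.lsr - 1 ∧
             c' = upR c i { s with lval := wval win, pc := .helpChk })
       | .wtr j =>
          let s := c.wst j
          (s.pc = .scanS ∧ x = s.a ∧
             (∃ hk : s.k < m,
               c' = upW c j { s with toHelp := if (⟨s.k, hk⟩ : Fin m) ∈ readersOf win then s.toHelp else insert (⟨s.k, hk⟩ : Fin m) s.toHelp, k := s.k + 1, pc := .scanH })) ∨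
          (s.pc = .postR ∧ x = s.mc.widx ∧
             c' = upW c j { s with win := win, pc := .postV }) ∨
          (s.pc = .postV ∧ x = s.mc.widx - 1 ∧
             c' = upW c j { s with val := wval win, pc := .postM })
       | .adt a =>
          let s := c.ast a
          (s.pc = .aR ∧ x = s.mc.widx ∧
             c' = upA c a { s with win := win, pc := .aV }) ∨
          (s.pc = .aV ∧ x = s.mc.widx - 1 ∧
             c' = upA c a { s with val := wval win, pc := .aret }))
  | .slrWrite p x e =>
      (match p with
       | .rdr i =>
          let s := c.rst i
          s.pc = .wSLR ∧ x = s.lsr ∧ e = .r i ∧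
          c' = { upR c i { s with pc := .rSLR } with
                 slr := Function.update c.slr x (slide (m + n) (c.slr x) e) }
       | .wtr j =>
          let s := c.wst j
          s.pc = .post ∧ x = s.mc.widx ∧ e = .w j s.v s.toHelp ∧
          c' = { upW c j { s with pc := .postR } with
                 slr := Function.update c.slr x (slide (m + n) (c.slr x) e) }
       | .adt _ => False)
  | .mRead p v =>
      v = c.M ∧
      (match p with
       | .rdr i =>
          let s := c.rst i
          (s.pc = .preM ∧
             c' = upR c i { s with mc := v, pc := if v.widx = s.lsr then RPC.preHelp else RPC.loopM }) ∨
          (s.pc = .loopM ∧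
             c' = upR c i (if s.lsr < v.ridx i then
                { s with mc := v, it := s.it + 1, lsr := v.ridx i, pc := .helpVal }
              else
                { s with mc := v, it := s.it + 1, lsr := v.widx, pc := .annH }))
       | .wtr j =>
          let s := c.wst j
          s.pc = .readM ∧
          c' = upW c j { s with mc := v, toHelp := ∅, k := 0, pc := .scanH }
       | .adt a =>
          let s := c.ast a
          s.pc = .aM ∧ c' = upA c a { s with mc := v, pc := .aR })
  | .mWrite p v =>
      (match p with
       | .rdr i =>
          let s := c.rst i
          (s.pc = .preHelp ∧ v = mArg s.mc s.win s.lsr s.lval ∧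
             c' = { upR c i { s with pc := .loopM } with M := wmax c.M v }) ∨
          (s.pc = .helpChk ∧ hasW s.win = true ∧ v = mArg s.mc s.win s.lsr s.lval ∧
             c' = { upR c i { s with pc := .loopEnd } with M := wmax c.M v })
       | .wtr j =>
          let s := c.wst j
          s.pc = .postM ∧ v = mArg s.mc s.win s.mc.widx s.val ∧
          c' = { upW c j { s with pc := .wret } with M := wmax c.M v }
       | .adt _ => False)
  | .hRead j k a =>
      let s := c.wst j
      s.pc = .scanH ∧ (k : ℕ) = s.k ∧ a = c.H k ∧
      c' = upW c j (if s.mc.ridx k < a then { s with a := a, pc := .scanS }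
                    else { s with k := s.k + 1 })
  | .hWrite i x =>
      let s := c.rst i
      s.pc = .annH ∧ x = s.lsr ∧
      c' = { upR c i { s with pc := .wSLR } with H := Function.update c.H i x }
  | .tau p =>
      match p with
      | .rdr i =>
          let s := c.rst i
          (s.pc = .helpChk ∧ hasW s.win = false ∧
             c' = upR c i { s with pc := .loopEnd }) ∨
          (s.pc = .loopEnd ∧
             c' = upR c i { s with pc := if i ∈ readersOf s.win then RPC.retNow else RPC.loopM })
      | .wtr j =>
          let s := c.wst j
          s.pc = .scanH ∧ s.k = m ∧ c' = upW c j { s with pc := .post }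
      | .adt _ => False

/-- The initial configuration: `SLR[-1]` holds `(w, j₀, v₀, ∅)`, all other
    sliding registers are empty, `M = (0, [-1,…,-1], ∅)`, `H = [-1,…,-1]`,
    and every process is idle (readers start with `lsr = -1`). -/
def init (m n : ℕ) (v0 : Val) (j0 : Fin n) : Config m n where
  slr := fun x => if x = -1 then [.w j0 v0 ∅] else []
  M := ⟨0, fun _ => -1, ∅⟩
  H := fun _ => -1
  rst := fun _ => ⟨-1, v0, ⟨0, fun _ => -1, ∅⟩, [], 0, .idle⟩
  wst := fun _ => ⟨v0, ⟨0, fun _ => -1, ∅⟩, ∅, 0, -1, [], v0, .idle⟩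
  ast := fun _ => ⟨⟨0, fun _ => -1, ∅⟩, [], v0, .idle⟩

/-- A finite execution of Algorithm 1: configurations `cfg 0, …, cfg len`
    connected by labelled steps. -/
structure Exec (m n : ℕ) (v0 : Val) (j0 : Fin n) where
  len : ℕ
  cfg : ℕ → Config m n
  lbl : ℕ → Lbl m n
  h0 : cfg 0 = init m n v0 j0
  hstep : ∀ t, t < len → Step (cfg t) (lbl t) (cfg (t + 1))

variable {v0 : Val} {j0 : Fin n}

/-! ### Derived notions -/

/-- The process performing a step. -/
def procOf : Lbl m n → Proc m n
  | .invRead i => .rdr i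
  | .respRead i _ => .rdr i
  | .invWrite j _ => .wtr j
  | .respWrite j => .wtr j
  | .invAudit a => .adt a
  | .respAudit a _ => .adt a
  | .slrRead p _ _ => p
  | .slrWrite p _ _ => p
  | .mRead p _ => p
  | .mWrite p _ => p
  | .hRead j _ _ => .wtr j
  | .hWrite i _ => .rdr i
  | .tau p => p

/-- The label writes a `w`-tuple to `SLR[x]`. -/
def isWWrite (l : Lbl m n) (x : ℤ) : Prop :=
  ∃ p j v h, l = .slrWrite p x (.w j v h)

/-- Step `t` is the first write of a `w`-tuple to `SLR[x]` in the execution. -/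
def FirstWWriteAt (E : Exec m n v0 j0) (x : ℤ) (t : ℕ) : Prop :=
  t < E.len ∧ isWWrite (E.lbl t) x ∧ ∀ t', t' < t → ¬ isWWrite (E.lbl t') x

/-- Step `t` changes `M.widx` from `ℓ - 1` to `ℓ`. -/
def WidxChangeAt (E : Exec m n v0 j0) (ℓ : ℤ) (t : ℕ) : Prop :=
  t < E.len ∧ (∃ p v, E.lbl t = .mWrite p v) ∧
  (E.cfg t).M.widx = ℓ - 1 ∧ (E.cfg (t + 1)).M.widx = ℓ

/-- `x` is the largest index of a sliding register containing a `w`-tuple. -/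
def WIDXis (c : Config m n) (x : ℤ) : Prop :=
  hasW (c.slr x) = true ∧ ∀ y : ℤ, x < y → hasW (c.slr y) = false

/-- Configuration in region `D_ℓ`: `M.widx = ℓ = WIDX + 1`. -/
def inD (c : Config m n) (ℓ : ℤ) : Prop := c.M.widx = ℓ ∧ WIDXis c (ℓ - 1)

/-- Configuration in region `E_ℓ`: `M.widx = ℓ = WIDX`. -/
def inE (c : Config m n) (ℓ : ℤ) : Prop := c.M.widx = ℓ ∧ WIDXis c ℓ

/-! ### Classification of operations, and linearizations -/

/-- Classification of the operations of Algorithm 1. -/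
inductive Kind where
  | silentR | directR | helpedR | visibleW | hiddenW | defA | nondefA
  deriving DecidableEq

/-- Rank used by the linearization rules `R1`–`R4` within a block of
    operations with the same index. -/
def rank : Kind → ℕ
  | .silentR => 0
  | .directR => 0
  | .nondefA => 0
  | .helpedR => 1
  | .defA => 2
  | .hiddenW => 3
  | .visibleW => 4

def Kind.isRead : Kind → Prop
  | .silentR => True | .directR => True | .helpedR => True
  | _ => False

def Kind.isWrite : Kind → Prop
  | .visibleW => True | .hiddenW => True
  | _ => False

def Kind.isAudit : Kind → Prop
  | .defA => True | .nondefA => True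
  | _ => False

/-- The data of a classified operation: its process, invocation step, optional
    response step, kind, associated sliding-register index `idx`, its
    characteristic step `key` on `SLR[idx]` (used by the linearization rules),
    its value (return value of a READ / input of a WRITE) and, for an AUDIT,
    the returned audit set. -/
structure OpData (m n : ℕ) where
  proc : Proc m n
  inv : ℕ
  resp : Option ℕ
  kind : Kind
  idx : ℤ
  key : ℕ
  val : Val
  aset : Finset (Fin m × Val)

/-- The label is a response event of process `p`. -/
def isRespOf (l : Lbl m n) (p : Proc m n) : Prop :=
  (∃ i v, p = .rdr i ∧ l = .respRead i v) ∨
  (∃ j, p = .wtr j ∧ l = .respWrite j) ∨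
  (∃ a A, p = .adt a ∧ l = .respAudit a A)

/-- `resp` is the matching response of the operation of `p` invoked at `a`
    (or the operation is pending if `resp = none`). -/
def RespMatch (E : Exec m n v0 j0) (p : Proc m n) (a : ℕ) : Option ℕ → Prop
  | some b => a < b ∧ b < E.len ∧ isRespOf (E.lbl b) p ∧
      ∀ t, a < t → t < b → ¬ isRespOf (E.lbl t) p
  | none => ∀ t, a < t → t < E.len → ¬ isRespOf (E.lbl t) p

/-- `x` is the smallest index `> x0` of a sliding register in which reader `i`
    is recorded (evaluated in the final configuration). -/
def minRecIdx (E : Exec m n v0 j0) (i : Fin m) (x0 x : ℤ) : Prop :=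
  x0 < x ∧ i ∈ readersOf ((E.cfg E.len).slr x) ∧
    ∀ y : ℤ, x0 < y → y < x → i ∉ readersOf ((E.cfg E.len).slr y)

/-- The return value of a classified READ: the actual response if the READ is
    complete; for a pending classified READ (completed in `H'`), the value of
    the first `w`-tuple of `SLR[idx-1]`. -/
def ReadValOK (E : Exec m n v0 j0) (o : OpData m n) (i : Fin m) : Prop :=
  match o.resp with
  | some b => E.lbl b = .respRead i o.val
  | none => o.val = wval ((E.cfg E.len).slr (o.idx - 1))

/-- `o` describes a classified operation of the execution `E`. -/
def IsOp (E : Exec m n v0 j0) (o : OpData m n) : Prop :=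
  o.inv < E.len ∧ RespMatch E o.proc o.inv o.resp ∧
  match o.kind with
  | .silentR =>
      ∃ i b win, o.proc = .rdr i ∧ o.resp = some b ∧
        E.lbl o.inv = .invRead i ∧
        (∃ t', t' < o.inv ∧ E.lbl t' = .invRead i) ∧
        o.idx = ((E.cfg o.inv).rst i).lsr ∧
        o.inv < o.key ∧ o.key < b ∧
        E.lbl o.key = .slrRead (.rdr i) o.idx win ∧
        ((E.cfg o.key).rst i).pc = .precheck ∧
        hasW win = false ∧
        E.lbl b = .respRead i o.val ∧
        o.aset = ∅
  | .directR =>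
      ∃ i, o.proc = .rdr i ∧ E.lbl o.inv = .invRead i ∧
        minRecIdx E i ((E.cfg o.inv).rst i).lsr o.idx ∧
        i ∈ preW ((E.cfg E.len).slr o.idx) ∧
        o.inv < o.key ∧ o.key < E.len ∧
        E.lbl o.key = .slrWrite (.rdr i) o.idx (.r i) ∧
        (∀ b, o.resp = some b → o.key < b) ∧
        ReadValOK E o i ∧ o.aset = ∅
  | .helpedR =>
      ∃ i, o.proc = .rdr i ∧ E.lbl o.inv = .invRead i ∧
        minRecIdx E i ((E.cfg o.inv).rst i).lsr o.idx ∧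
        i ∉ preW ((E.cfg E.len).slr o.idx) ∧
        o.key = o.inv ∧ ReadValOK E o i ∧ o.aset = ∅
  | .visibleW =>
      ∃ j h, o.proc = .wtr j ∧ E.lbl o.inv = .invWrite j o.val ∧
        o.inv < o.key ∧ o.key < E.len ∧
        E.lbl o.key = .slrWrite (.wtr j) o.idx (.w j o.val h) ∧
        (∀ b, o.resp = some b → o.key < b) ∧
        firstW ((E.cfg E.len).slr o.idx) = some (j, o.val, h) ∧
        o.aset = ∅
  | .hiddenW =>
      ∃ j h, o.proc = .wtr j ∧ E.lbl o.inv = .invWrite j o.val ∧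
        o.inv < o.key ∧ o.key < E.len ∧
        E.lbl o.key = .slrWrite (.wtr j) o.idx (.w j o.val h) ∧
        (∀ b, o.resp = some b → o.key < b) ∧
        firstW ((E.cfg E.len).slr o.idx) ≠ some (j, o.val, h) ∧
        o.aset = ∅
  | .defA =>
      ∃ a b tM mv win, o.proc = .adt a ∧ o.resp = some b ∧
        E.lbl o.inv = .invAudit a ∧
        o.inv < tM ∧ tM < o.key ∧ o.key < b ∧
        E.lbl tM = .mRead (.adt a) mv ∧ ((E.cfg tM).ast a).pc = .aM ∧
        o.idx = mv.widx ∧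
        E.lbl o.key = .slrRead (.adt a) o.idx win ∧
        ((E.cfg o.key).ast a).pc = .aR ∧
        hasW win = true ∧
        E.lbl b = .respAudit a o.aset ∧ o.val = 0
  | .nondefA =>
      ∃ a b tM mv win, o.proc = .adt a ∧ o.resp = some b ∧
        E.lbl o.inv = .invAudit a ∧
        o.inv < tM ∧ tM < o.key ∧ o.key < b ∧
        E.lbl tM = .mRead (.adt a) mv ∧ ((E.cfg tM).ast a).pc = .aM ∧
        o.idx = mv.widx ∧
        E.lbl o.key = .slrRead (.adt a) o.idx win ∧
        ((E.cfg o.key).ast a).pc = .aR ∧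
        hasW win = false ∧
        E.lbl b = .respAudit a o.aset ∧ o.val = 0

/-- `o` terminates (its response event occurs) before `o'` starts. -/
def EndsBefore (o o' : OpData m n) : Prop :=
  ∃ b, o.resp = some b ∧ b < o'.inv

/-- `lt` is a linearization of the classified operations of `E` obeying the
    rules `R0`–`R4`: a strict total order on classified operations, ordering
    operations by increasing `idx` (`R0`); within the same `idx`, first
    silent READs, direct READs and non-definitive AUDITs ordered by their
    characteristic step on `SLR[idx]` (`R1`), then helped READs in arbitrary
    order followed by the definitive AUDITs ordered by their read of
    `SLR[idx]` (`R2`), then the hidden WRITEs ordered by their write to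
    `SLR[idx]` (`R3`), and the visible WRITE last (`R4`). -/
def LinOK (E : Exec m n v0 j0) (lt : OpData m n → OpData m n → Prop) : Prop :=
  (∀ o, IsOp E o → ¬ lt o o) ∧
  (∀ o₁ o₂ o₃, IsOp E o₁ → IsOp E o₂ → IsOp E o₃ →
      lt o₁ o₂ → lt o₂ o₃ → lt o₁ o₃) ∧
  (∀ o₁ o₂, IsOp E o₁ → IsOp E o₂ → o₁ ≠ o₂ → lt o₁ o₂ ∨ lt o₂ o₁) ∧
  (∀ o₁ o₂, IsOp E o₁ → IsOp E o₂ → o₁.idx < o₂.idx → lt o₁ o₂) ∧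
  (∀ o₁ o₂, IsOp E o₁ → IsOp E o₂ → o₁.idx = o₂.idx →
      rank o₁.kind < rank o₂.kind → lt o₁ o₂) ∧
  (∀ o₁ o₂, IsOp E o₁ → IsOp E o₂ → o₁.idx = o₂.idx →
      rank o₁.kind = rank o₂.kind → o₁.kind ≠ .helpedR →
      o₁.key < o₂.key → lt o₁ o₂)

/-! ### Windows -/

def eid : Entry m n → Fin m ⊕ Fin n
  | .w j _ _ => .inr j
  | .r i => .inl i

theorem hasW_append (l l' : List (Entry m n)) : hasW (l ++ l') = (hasW l || hasW l') := by
  simp [hasW]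

theorem firstW_append {l : List (Entry m n)} (l' : List (Entry m n)) (h : hasW l = true) :
    firstW (l ++ l') = firstW l := by
  induction l with
  | nil => simp [hasW] at h
  | cons e l ih =>
    cases e with
    | w j v s => rfl
    | r i => exact ih (by simpa [hasW, Entry.isW] using h)

theorem firstW_append' {l : List (Entry m n)} (l' : List (Entry m n)) (h : hasW l = false) :
    firstW (l ++ l') = firstW l' := by
  induction l with
  | nil => rfl
  | cons e l ih =>
    cases e with
    | w j v s => simp [hasW, Entry.isW] at h
    | r i => exact ih (by simpa [hasW, Entry.isW] using h)

theorem firstW_none {l : List (Entry m n)} (h : hasW l = false) : firstW l = none := by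
  simpa [firstW] using firstW_append' [] h

theorem preW_append {l : List (Entry m n)} (l' : List (Entry m n)) (h : hasW l = true) :
    preW (l ++ l') = preW l := by
  induction l with
  | nil => simp [hasW] at h
  | cons e l ih =>
    cases e with
    | w j v s => rfl
    | r i =>
      have := ih (by simpa [hasW, Entry.isW] using h)
      simp [preW, this]

theorem preW_append' {l : List (Entry m n)} (l' : List (Entry m n)) (h : hasW l = false) :
    preW (l ++ l') = preW l ∪ preW l' := by
  induction l with
  | nil => simp [preW]
  | cons e l ih =>
    cases e with
    | w j v s => simp [hasW, Entry.isW] at h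
    | r i =>
      have := ih (by simpa [hasW, Entry.isW] using h)
      simp [preW, this]

theorem readersOf_append {l : List (Entry m n)} (l' : List (Entry m n)) (h : hasW l = true) :
    readersOf (l ++ l') = readersOf l := by
  simp [readersOf, firstW_append _ h, preW_append _ h]

theorem readersOf_append' {l : List (Entry m n)} (l' : List (Entry m n)) (h : hasW l = false) :
    readersOf (l ++ l') = preW l ∪ readersOf l' := by
  simp [readersOf, firstW_append' _ h, preW_append' _ h]

theorem readersOf_noW {l : List (Entry m n)} (h : hasW l = false) : readersOf l = preW l := by
  simp [readersOf, firstW_none h]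

theorem hasW_prefix {l l' : List (Entry m n)} (h : l <+: l') (hw : hasW l = true) :
    hasW l' = true := by
  obtain ⟨k, rfl⟩ := h
  simp [hasW_append, hw]

theorem readersOf_prefix {l l' : List (Entry m n)} (h : l <+: l') (hw : hasW l = true) :
    readersOf l' = readersOf l := by
  obtain ⟨k, rfl⟩ := h
  exact readersOf_append _ hw

theorem wval_prefix {l l' : List (Entry m n)} (h : l <+: l') (hw : hasW l = true) :
    wval l' = wval l := by
  obtain ⟨k, rfl⟩ := h
  simp [wval, firstW_append _ hw]

theorem readersOf_mono {l l' : List (Entry m n)} (h : l <+: l') {i : Fin m}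
    (hi : i ∈ readersOf l) : i ∈ readersOf l' := by
  cases hw : hasW l with
  | true => rwa [readersOf_prefix h hw]
  | false =>
    obtain ⟨k, rfl⟩ := h
    rw [readersOf_append' _ hw]
    rw [readersOf_noW hw] at hi
    exact Finset.mem_union_left _ hi

theorem mem_preW {l : List (Entry m n)} {i : Fin m} (h : Entry.r i ∈ l) (hw : hasW l = false) :
    i ∈ preW l := by
  induction l with
  | nil => simp at h
  | cons e l ih =>
    cases e with
    | w j v s => simp [hasW, Entry.isW] at hw
    | r k =>
      have hw' : hasW l = false := by simpa [hasW, Entry.isW] using hw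
      simp only [List.mem_cons, Entry.r.injEq] at h
      rcases h with rfl | h
      · simp [preW]
      · simp [preW, ih h hw']

theorem mem_readersOf {l : List (Entry m n)} {i : Fin m} (h : Entry.r i ∈ l)
    (hw : hasW l = false) : i ∈ readersOf l := by
  rw [readersOf_noW hw]; exact mem_preW h hw

theorem hasW_of_mem {l : List (Entry m n)} {j v h} (hm : Entry.w j v h ∈ l) : hasW l = true := by
  simp only [hasW, List.any_eq_true]
  exact ⟨_, hm, rfl⟩

theorem slide_eq {l : List (Entry m n)} {e : Entry m n}
    (h : ((l ++ [e]).map eid).Nodup) : slide (m + n) l e = l ++ [e] := by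
  have := h.length_le_card
  simp only [List.length_map, Fintype.card_sum, Fintype.card_fin] at this
  simp only [slide]
  rw [Nat.sub_eq_zero_of_le this, List.drop_zero]

/-! ### Invariants -/

def Ext (S S' : ℤ → List (Entry m n)) : Prop := ∀ y, S y <+: S' y

theorem Ext.refl (S : ℤ → List (Entry m n)) : Ext S S := fun _ => List.prefix_rfl

theorem Ext.upd (S : ℤ → List (Entry m n)) (x : ℤ) (e : Entry m n) :
    Ext S (Function.update S x (S x ++ [e])) := by
  intro y
  by_cases h : y = x
  · subst h; simp
  · simp [h]

/-- The content `mv` is an admissible content of the max register. -/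
structure MOK (S : ℤ → List (Entry m n)) (mv : MVal m) : Prop where
  nn : 0 ≤ mv.widx
  hw : ∀ y, -1 ≤ y → y < mv.widx → hasW (S y) = true
  rc : ∀ i y, 0 ≤ y → y < mv.widx → i ∈ readersOf (S y) →
    y ≤ mv.ridx i ∧ (i, wval (S (y - 1))) ∈ mv.aud
  rx : ∀ i, mv.ridx i = -1 ∨ (0 ≤ mv.ridx i ∧ mv.ridx i < mv.widx ∧ i ∈ readersOf (S (mv.ridx i)))

theorem MOK.mono {S S' : ℤ → List (Entry m n)} {mv : MVal m} (h : MOK S mv) (he : Ext S S') :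
    MOK S' mv where
  nn := h.nn
  hw y h1 h2 := hasW_prefix (he y) (h.hw y h1 h2)
  rc i y h1 h2 h3 := by
    rw [readersOf_prefix (he y) (h.hw y (by omega) h2)] at h3
    rw [wval_prefix (he (y-1)) (h.hw _ (by omega) (by omega))]
    exact h.rc i y h1 h2 h3
  rx i := by
    rcases h.rx i with h1 | ⟨h1, h2, h3⟩
    · exact .inl h1
    · exact .inr ⟨h1, h2, readersOf_mono (he _) h3⟩

theorem MOK.arg {S : ℤ → List (Entry m n)} {mv : MVal m} (h : MOK S mv)
    {win : List (Entry m n)} (hp : win <+: S mv.widx) (hw : hasW win = true) :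
    MOK S (mArg mv win mv.widx (wval (S (mv.widx - 1)))) where
  nn := by have := h.nn; simp only [mArg]; omega
  hw y h1 h2 := by
    simp only [mArg] at h2
    by_cases hy : y = mv.widx
    · subst hy; exact hasW_prefix hp hw
    · exact h.hw y h1 (by omega)
  rc i y h1 h2 h3 := by
    simp only [mArg] at h2 ⊢
    by_cases hy : y = mv.widx
    · subst hy
      rw [readersOf_prefix hp hw] at h3
      simp [h3]
    · obtain ⟨h4, h5⟩ := h.rc i y h1 (by omega) h3
      refine ⟨?_, Finset.mem_union_left _ h5⟩
      split_ifs <;> omega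
  rx i := by
    simp only [mArg]
    split_ifs with h1
    · exact .inr ⟨h.nn, by omega, readersOf_mono hp h1⟩
    · rcases h.rx i with h1 | ⟨h1, h2, h3⟩
      · exact .inl h1
      · exact .inr ⟨h1, by omega, h3⟩

theorem MOK.wmax {S : ℤ → List (Entry m n)} {a b : MVal m} (ha : MOK S a) (hb : MOK S b) :
    MOK S (wmax a b) := by
  unfold Alg1.wmax; split_ifs <;> assumption

theorem wmax_le (a b : MVal m) : a.widx ≤ (wmax a b).widx := by
  unfold Alg1.wmax; split_ifs <;> omega

theorem wmax_le' (a b : MVal m) : b.widx ≤ (wmax a b).widx := by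
  unfold Alg1.wmax; split_ifs <;> omega

def Good (S : ℤ → List (Entry m n)) (s : RState m n) (i : Fin m) : Prop :=
  s.lval = wval (S (s.lsr - 1)) ∧ i ∈ readersOf (S s.lsr)

/-- Local invariant of a reader, by program counter. -/
def RLoc (S : ℤ → List (Entry m n)) (W : ℤ) (s : RState m n) (i : Fin m) : RPC → Prop
  | .idle => s.lsr = -1 ∨ (0 ≤ s.lsr ∧ Good S s i)
  | .retNow => 0 ≤ s.lsr ∧ Good S s i
  | .precheck => 0 ≤ s.lsr ∧ Good S s i
  | .preM => 0 ≤ s.lsr ∧ Good S s i ∧ s.win <+: S s.lsr ∧ hasW s.win = true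
  | .preHelp => 0 ≤ s.lsr ∧ Good S s i ∧ s.win <+: S s.lsr ∧ hasW s.win = true ∧
      s.mc.widx = s.lsr
  | .loopM => s.lsr < W
  | .helpVal => 0 ≤ s.lsr ∧ s.lsr < W ∧ i ∈ readersOf (S s.lsr)
  | .annH => s.mc.widx = s.lsr ∧ ∀ x, Entry.r i ∈ S x → x < s.lsr
  | .wSLR => s.mc.widx = s.lsr ∧ ∀ x, Entry.r i ∈ S x → x < s.lsr
  | .rSLR => s.mc.widx = s.lsr ∧ Entry.r i ∈ S s.lsr
  | .gVal => s.mc.widx = s.lsr ∧ s.win <+: S s.lsr ∧ Entry.r i ∈ s.win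
  | .helpChk => s.mc.widx = s.lsr ∧ s.win <+: S s.lsr ∧ Entry.r i ∈ s.win ∧
      s.lval = wval (S (s.lsr - 1))
  | .loopEnd => s.mc.widx = s.lsr ∧ s.win <+: S s.lsr ∧ Entry.r i ∈ s.win ∧
      s.lval = wval (S (s.lsr - 1)) ∧ (hasW s.win = true → s.lsr < W)

structure RInv (S : ℤ → List (Entry m n)) (W h : ℤ) (s : RState m n) (i : Fin m) : Prop where
  lo : -1 ≤ s.lsr
  hi : s.lsr ≤ W
  hh : h ≤ s.lsr
  mc : MOK S s.mc
  mcw : s.mc.widx ≤ W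
  mem : ∀ x, Entry.r i ∈ S x → x ≤ s.lsr
  loc : RLoc S W s i s.pc

theorem RInv.mono {S S' : ℤ → List (Entry m n)} {W W' h : ℤ} {s : RState m n} {i : Fin m}
    (H : RInv S W h s i) (he : Ext S S') (hW : W ≤ W')
    (hS : ∀ y, -1 ≤ y → y < W → hasW (S y) = true)
    (hm : ∀ x, Entry.r i ∈ S' x → Entry.r i ∈ S x) : RInv S' W' h s i where
  lo := H.lo
  hi := H.hi.trans hW
  hh := H.hh
  mc := H.mc.mono he
  mcw := H.mcw.trans hW
  mem x hx := H.mem x (hm x hx)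
  loc := by
    have hl := H.loc
    have hi := H.hi
    have nn := H.mc.nn
    have hv : 0 ≤ s.lsr → wval (S' (s.lsr - 1)) = wval (S (s.lsr - 1)) := fun h0 =>
      wval_prefix (he _) (hS _ (by omega) (by omega))
    have hr : i ∈ readersOf (S s.lsr) → i ∈ readersOf (S' s.lsr) := readersOf_mono (he _)
    have hp : s.win <+: S s.lsr → s.win <+: S' s.lsr := fun h => h.trans (he _)
    have hg : 0 ≤ s.lsr → Good S s i → Good S' s i := fun h0 h => ⟨h.1.trans (hv h0).symm, hr h.2⟩
    cases hpc : s.pc <;> rw [hpc] at hl <;> simp only [RLoc] at hl ⊢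
    case idle => exact hl.imp id fun h => ⟨h.1, hg h.1 h.2⟩
    case retNow => exact ⟨hl.1, hg hl.1 hl.2⟩
    case precheck => exact ⟨hl.1, hg hl.1 hl.2⟩
    case preM => exact ⟨hl.1, hg hl.1 hl.2.1, hp hl.2.2.1, hl.2.2.2⟩
    case preHelp => exact ⟨hl.1, hg hl.1 hl.2.1, hp hl.2.2.1, hl.2.2.2⟩
    case loopM => omega
    case helpVal => exact ⟨hl.1, by omega, hr hl.2.2⟩
    case annH => exact ⟨hl.1, fun x hx => hl.2 x (hm x hx)⟩
    case wSLR => exact ⟨hl.1, fun x hx => hl.2 x (hm x hx)⟩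
    case rSLR => exact ⟨hl.1, (he _).subset hl.2⟩
    case gVal => exact ⟨hl.1, hp hl.2.1, hl.2.2⟩
    case helpChk => exact ⟨hl.1, hp hl.2.1, hl.2.2.1, hl.2.2.2.trans (hv (by omega)).symm⟩
    case loopEnd =>
      exact ⟨hl.1, hp hl.2.1, hl.2.2.1, hl.2.2.2.1.trans (hv (by omega)).symm,
        fun h => by have := hl.2.2.2.2 h; omega⟩

/-- Local invariant of a writer, by program counter. -/
def WLoc (S : ℤ → List (Entry m n)) (W : ℤ) (L : Fin m → ℤ) (s : WState m n) (j : Fin n) :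
    WPC → Prop
  | .idle => ∀ x v h, Entry.w j v h ∈ S x → x < W
  | .readM => ∀ x v h, Entry.w j v h ∈ S x → x < W
  | .scanH => ∀ x v h, Entry.w j v h ∈ S x → x < s.mc.widx
  | .scanS => (∀ x v h, Entry.w j v h ∈ S x → x < s.mc.widx) ∧
      ∀ hk : s.k < m, s.mc.ridx ⟨s.k, hk⟩ < L ⟨s.k, hk⟩
  | .post => ∀ x v h, Entry.w j v h ∈ S x → x < s.mc.widx
  | .postR => (∀ x v h, Entry.w j v h ∈ S x → x ≤ s.mc.widx) ∧ hasW (S s.mc.widx) = true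
  | .postV => (∀ x v h, Entry.w j v h ∈ S x → x ≤ s.mc.widx) ∧ hasW s.win = true ∧
      s.win <+: S s.mc.widx
  | .postM => (∀ x v h, Entry.w j v h ∈ S x → x ≤ s.mc.widx) ∧ hasW s.win = true ∧
      s.win <+: S s.mc.widx ∧ s.val = wval (S (s.mc.widx - 1))
  | .wret => ∀ x v h, Entry.w j v h ∈ S x → x < W

structure WInv (S : ℤ → List (Entry m n)) (W : ℤ) (L : Fin m → ℤ) (s : WState m n) (j : Fin n) :
    Prop where
  mc : MOK S s.mc
  mcw : s.mc.widx ≤ W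
  help : ∀ i ∈ s.toHelp, s.mc.ridx i < L i
  loc : WLoc S W L s j s.pc

theorem WInv.mono {S S' : ℤ → List (Entry m n)} {W W' : ℤ} {L L' : Fin m → ℤ}
    {s : WState m n} {j : Fin n}
    (H : WInv S W L s j) (he : Ext S S') (hW : W ≤ W') (hL : ∀ i, L i ≤ L' i)
    (hm : ∀ x v h, Entry.w j v h ∈ S' x → Entry.w j v h ∈ S x) : WInv S' W' L' s j where
  mc := H.mc.mono he
  mcw := H.mcw.trans hW
  help i hi := (H.help i hi).trans_le (hL i)
  loc := by
    have hl := H.loc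
    have nn := H.mc.nn
    have hv : wval (S' (s.mc.widx - 1)) = wval (S (s.mc.widx - 1)) :=
      wval_prefix (he _) (H.mc.hw _ (by omega) (by omega))
    cases hpc : s.pc <;> rw [hpc] at hl <;> simp only [WLoc] at hl ⊢
    case idle => exact fun x v h hx => (hl x v h (hm x v h hx)).trans_le hW
    case readM => exact fun x v h hx => (hl x v h (hm x v h hx)).trans_le hW
    case wret => exact fun x v h hx => (hl x v h (hm x v h hx)).trans_le hW
    case scanH => exact fun x v h hx => hl x v h (hm x v h hx)
    case post => exact fun x v h hx => hl x v h (hm x v h hx)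
    case scanS => exact ⟨fun x v h hx => hl.1 x v h (hm x v h hx),
      fun hk => (hl.2 hk).trans_le (hL _)⟩
    case postR => exact ⟨fun x v h hx => hl.1 x v h (hm x v h hx), hasW_prefix (he _) hl.2⟩
    case postV => exact ⟨fun x v h hx => hl.1 x v h (hm x v h hx), hl.2.1, hl.2.2.trans (he _)⟩
    case postM => exact ⟨fun x v h hx => hl.1 x v h (hm x v h hx), hl.2.1, hl.2.2.1.trans (he _),
      hl.2.2.2.trans hv.symm⟩

/-- The global invariant. -/
structure Inv (c : Config m n) : Prop where
  mok : MOK c.slr c.M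
  nd : ∀ x, ((c.slr x).map eid).Nodup
  emp : ∀ x, c.M.widx < x → c.slr x = []
  u : ∀ i y1 y2, 0 ≤ y1 → y1 < y2 → i ∈ readersOf (c.slr y1) → i ∈ readersOf (c.slr y2) →
    y1 ≤ (c.rst i).lsr
  r : ∀ i, RInv c.slr c.M.widx (c.H i) (c.rst i) i
  w : ∀ j, WInv c.slr c.M.widx (fun i => (c.rst i).lsr) (c.wst j) j

theorem inv_init : Inv (init m n v0 j0) := by
  have hmok : MOK (init m n v0 j0).slr (⟨0, fun _ => -1, ∅⟩ : MVal m) := by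
    refine ⟨le_refl _, ?_, ?_, ?_⟩
    · intro y h1 h2
      have : y = -1 := by simp only at h2; omega
      subst this; rfl
    · intro i y h1 h2; simp only at h2; omega
    · intro i; exact .inl rfl
  have hmem : ∀ x i, Entry.r i ∉ (init m n v0 j0).slr x := by
    intro x i; simp only [init]; split_ifs <;> simp
  refine ⟨hmok, ?_, ?_, ?_, ?_, ?_⟩
  · intro x; simp only [init]; split_ifs <;> simp
  · intro x hx; simp only [init] at hx ⊢; rw [if_neg (by omega)]
  · intro i y1 y2 h0 h1 h2
    simp only [init] at h2
    rw [if_neg (by omega)] at h2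
    simp [readersOf, preW, firstW] at h2
  · intro i
    exact ⟨le_refl _, by simp [init], le_refl _, hmok, le_refl _,
      fun x hx => absurd hx (hmem x i), .inl rfl⟩
  · intro j
    refine ⟨hmok, le_refl _, by simp [init], ?_⟩
    intro x v h hx
    simp only [init] at hx ⊢
    split_ifs at hx with h1
    · omega
    · simp at hx

theorem Inv.upR {c : Config m n} (I : Inv c) (i : Fin m) (s : RState m n)
    (hs : RInv c.slr c.M.widx (c.H i) s i) (hl : (c.rst i).lsr ≤ s.lsr) :
    Inv (upR c i s) := by
  have hL : ∀ k, (c.rst k).lsr ≤ (Function.update c.rst i s k).lsr := by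
    intro k
    by_cases h : k = i
    · subst h; simpa using hl
    · simp [h]
  refine ⟨I.mok, I.nd, I.emp, ?_, ?_, ?_⟩
  · intro k y1 y2 h0 h1 h2 h3
    exact (I.u k y1 y2 h0 h1 h2 h3).trans (hL k)
  · intro k
    by_cases h : k = i
    · subst h; simpa [Alg1.upR] using hs
    · simpa [Alg1.upR, h] using I.r k
  · intro j
    exact (I.w j).mono (Ext.refl _) le_rfl hL (fun _ _ _ h => h)

theorem Inv.upW {c : Config m n} (I : Inv c) (j : Fin n) (s : WState m n)
    (hs : WInv c.slr c.M.widx (fun i => (c.rst i).lsr) s j) :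
    Inv (upW c j s) := by
  refine ⟨I.mok, I.nd, I.emp, I.u, I.r, ?_⟩
  intro k
  by_cases h : k = j
  · subst h; simpa [Alg1.upW] using hs
  · simpa [Alg1.upW, h] using I.w k

theorem Inv.setM {c : Config m n} (I : Inv c) (mv : MVal m) (h : MOK c.slr mv) :
    Inv { c with M := wmax c.M mv } := by
  have hle := wmax_le c.M mv
  refine ⟨I.mok.wmax h, I.nd, fun x hx => I.emp x (lt_of_le_of_lt hle hx), I.u, ?_, ?_⟩
  · intro i
    exact (I.r i).mono (Ext.refl _) hle I.mok.hw (fun _ h => h)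
  · intro j
    exact (I.w j).mono (Ext.refl _) hle (fun _ => le_rfl) (fun _ _ _ h => h)

theorem Inv.setH {c : Config m n} (I : Inv c) (i : Fin m) :
    Inv { c with H := Function.update c.H i (c.rst i).lsr } := by
  refine ⟨I.mok, I.nd, I.emp, I.u, ?_, I.w⟩
  intro k
  have := I.r k
  refine ⟨this.lo, this.hi, ?_, this.mc, this.mcw, this.mem, this.loc⟩
  by_cases h : k = i
  · subst h; simp
  · simpa [h] using this.hh

theorem upd_mem {S : ℤ → List (Entry m n)} {x y : ℤ} {e e' : Entry m n}
    (h : e' ∈ Function.update S x (S x ++ [e]) y) : e' ∈ S y ∨ (y = x ∧ e' = e) := by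
  by_cases hy : y = x
  · subst hy
    simpa using h
  · left; simpa [hy] using h

theorem nodup_upd {S : ℤ → List (Entry m n)} (hn : ∀ x, ((S x).map eid).Nodup) {x : ℤ}
    {e : Entry m n} (hf : ∀ e' ∈ S x, eid e' ≠ eid e) :
    ∀ y, ((Function.update S x (S x ++ [e]) y).map eid).Nodup := by
  intro y
  by_cases hy : y = x
  · subst hy
    simp only [Function.update_self, List.map_append, List.map_cons, List.map_nil]
    refine List.Nodup.append (hn _) (by simp) ?_
    intro a ha hb
    simp only [List.mem_map] at ha
    obtain ⟨e', h1, h2⟩ := ha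
    simp only [List.mem_singleton] at hb
    exact hf e' h1 (h2.trans hb)
  · simpa [hy] using hn y

theorem Inv.slrR {c : Config m n} (I : Inv c) (i : Fin m) (hpc : (c.rst i).pc = .wSLR) :
    Ext c.slr (Function.update c.slr (c.rst i).lsr
        (slide (m + n) (c.slr (c.rst i).lsr) (.r i))) ∧
    Inv { Alg1.upR c i { c.rst i with pc := .rSLR } with
      slr := Function.update c.slr (c.rst i).lsr
        (slide (m + n) (c.slr (c.rst i).lsr) (.r i)) } := by
  have R := I.r i
  have hl := R.loc
  rw [hpc] at hl
  obtain ⟨hw, hfr⟩ := hl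
  have hnd := nodup_upd I.nd (x := (c.rst i).lsr) (e := .r i) (by
    intro e' he' hc
    cases e' with
    | w j v h => simp [eid] at hc
    | r k =>
      simp only [eid, Sum.inl.injEq] at hc
      subst hc
      exact lt_irrefl _ (hfr _ he'))
  have hsl : slide (m + n) (c.slr (c.rst i).lsr) (.r i) = c.slr (c.rst i).lsr ++ [.r i] := by
    apply slide_eq
    simpa using hnd (c.rst i).lsr
  rw [hsl]
  have he := Ext.upd c.slr (c.rst i).lsr (.r i)
  refine ⟨he, ?_⟩
  set x := (c.rst i).lsr with hx
  have hL : ∀ k, (c.rst k).lsr = (Function.update c.rst i { c.rst i with pc := .rSLR } k).lsr := by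
    intro k
    by_cases h : k = i
    · subst h; simp
    · simp [h]
  have hrec : ∀ k y, k ∈ readersOf (Function.update c.slr x (c.slr x ++ [.r i]) y) →
      k ∈ readersOf (c.slr y) ∨ (k = i ∧ y = x) := by
    intro k y hk
    by_cases hy : y = x
    · subst hy
      rw [Function.update_self] at hk
      cases hw : hasW (c.slr x) with
      | true => rw [readersOf_append _ hw] at hk; exact .inl hk
      | false =>
        rw [readersOf_append' _ hw, Finset.mem_union] at hk
        rcases hk with hk | hk
        · rw [readersOf_noW hw]; exact .inl hk
        · right
          simpa [readersOf, preW, firstW] using hk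
    · rw [Function.update_of_ne hy] at hk; exact .inl hk
  refine ⟨I.mok.mono he, hnd, ?_, ?_, ?_, ?_⟩
  · intro y hy
    have : y ≠ x := by have := R.hi; simp only [Alg1.upR] at hy; omega
    simpa [this] using I.emp y hy
  · intro k y1 y2 h0 h1 h2 h3
    simp only [Alg1.upR]
    rw [← hL]
    rcases hrec _ _ h2 with h2 | ⟨rfl, rfl⟩
    · rcases hrec _ _ h3 with h3 | ⟨rfl, rfl⟩
      · exact I.u k y1 y2 h0 h1 h2 h3
      · exact h1.le
    · exact le_rfl
  · intro k
    by_cases h : k = i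
    · subst h
      simp only [Alg1.upR, Function.update_self]
      refine ⟨R.lo, R.hi, R.hh, R.mc.mono he, R.mcw, ?_, ?_⟩
      · intro y hy
        rcases upd_mem hy with hy | ⟨rfl, -⟩
        · exact R.mem y hy
        · exact le_rfl
      · refine ⟨hw, ?_⟩
        change _ ∈ Function.update c.slr x _ x
        simp
    · simp only [Alg1.upR, Function.update_of_ne h]
      refine (I.r k).mono he le_rfl I.mok.hw ?_
      intro y hy
      rcases upd_mem hy with hy | ⟨-, hy⟩
      · exact hy
      · simp only [Entry.r.injEq] at hy; exact absurd hy h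
  · intro j
    refine (I.w j).mono he le_rfl (fun k => (hL k).le) ?_
    intro y v h hy
    rcases upd_mem hy with hy | ⟨-, hy⟩
    · exact hy
    · simp at hy

theorem Inv.slrW {c : Config m n} (I : Inv c) (j : Fin n) (hpc : (c.wst j).pc = .post) :
    Ext c.slr (Function.update c.slr (c.wst j).mc.widx
        (slide (m + n) (c.slr (c.wst j).mc.widx) (.w j (c.wst j).v (c.wst j).toHelp))) ∧
    Inv { Alg1.upW c j { c.wst j with pc := .postR } with
      slr := Function.update c.slr (c.wst j).mc.widx
        (slide (m + n) (c.slr (c.wst j).mc.widx) (.w j (c.wst j).v (c.wst j).toHelp)) } := by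
  have R := I.w j
  have hfr := R.loc
  rw [hpc] at hfr
  simp only [WLoc] at hfr
  have hnd := nodup_upd I.nd (x := (c.wst j).mc.widx) (e := .w j (c.wst j).v (c.wst j).toHelp) (by
    intro e' he' hc
    cases e' with
    | w k v h =>
      simp only [eid, Sum.inr.injEq] at hc
      subst hc
      exact lt_irrefl _ (hfr _ _ _ he')
    | r k => simp [eid] at hc)
  have hsl : slide (m + n) (c.slr (c.wst j).mc.widx) (.w j (c.wst j).v (c.wst j).toHelp)
      = c.slr (c.wst j).mc.widx ++ [.w j (c.wst j).v (c.wst j).toHelp] := by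
    apply slide_eq
    simpa using hnd (c.wst j).mc.widx
  rw [hsl]
  have he := Ext.upd c.slr (c.wst j).mc.widx (.w j (c.wst j).v (c.wst j).toHelp)
  refine ⟨he, ?_⟩
  have hx0 := R.mc.nn
  have hxW := R.mcw
  set x := (c.wst j).mc.widx with hx
  have hemp : ∀ y, c.M.widx < y →
      Function.update c.slr x (c.slr x ++ [.w j (c.wst j).v (c.wst j).toHelp]) y = [] := by
    intro y hy
    have : y ≠ x := by omega
    simpa [this] using I.emp y hy
  have hrec : ∀ k y, k ∈ readersOf (Function.update c.slr x
      (c.slr x ++ [.w j (c.wst j).v (c.wst j).toHelp]) y) →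
      k ∈ readersOf (c.slr y) ∨ (k ∈ (c.wst j).toHelp ∧ y = x ∧ x = c.M.widx) := by
    intro k y hk
    by_cases hy : y = x
    · subst hy
      rw [Function.update_self] at hk
      cases hw : hasW (c.slr x) with
      | true => rw [readersOf_append _ hw] at hk; exact .inl hk
      | false =>
        rw [readersOf_append' _ hw, Finset.mem_union] at hk
        rcases hk with hk | hk
        · rw [readersOf_noW hw]; exact .inl hk
        · right
          refine ⟨by simpa [readersOf, preW, firstW] using hk, rfl, ?_⟩
          by_contra hne
          have := I.mok.hw x (by omega) (by omega)
          simp [this] at hw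
    · rw [Function.update_of_ne hy] at hk; exact .inl hk
  refine ⟨I.mok.mono he, hnd, hemp, ?_, ?_, ?_⟩
  · intro k y1 y2 h0 h1 h2 h3
    change y1 ≤ (c.rst k).lsr
    have hy2 : y2 ≤ c.M.widx := by
      by_contra hlt
      simp only at h3
      rw [hemp y2 (by omega)] at h3
      simp [readersOf, preW, firstW] at h3
    rcases hrec _ _ h2 with h2 | ⟨-, rfl, h2⟩
    · rcases hrec _ _ h3 with h3 | ⟨hk, rfl, -⟩
      · exact I.u k y1 y2 h0 h1 h2 h3
      · have h4 := (R.mc.rc k y1 h0 h1 h2).1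
        have h5 := R.help k hk
        omega
    · omega
  · intro k
    refine (I.r k).mono he le_rfl I.mok.hw ?_
    intro y hy
    rcases upd_mem hy with hy | ⟨-, hy⟩
    · exact hy
    · simp at hy
  · intro k
    by_cases h : k = j
    · subst h
      simp only [Alg1.upW, Function.update_self]
      refine ⟨R.mc.mono he, R.mcw, R.help, ?_⟩
      refine ⟨?_, ?_⟩
      · intro y v h hy
        rcases upd_mem hy with hy | ⟨rfl, -⟩
        · exact (hfr _ _ _ hy).le
        · exact le_rfl
      · change hasW (Function.update c.slr x _ x) = true
        simp [hasW, Entry.isW]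
    · simp only [Alg1.upW, Function.update_of_ne h]
      refine (I.w k).mono he le_rfl (fun _ => le_rfl) ?_
      intro y v h' hy
      rcases upd_mem hy with hy | ⟨-, hy⟩
      · exact hy
      · simp only [Entry.w.injEq] at hy; exact absurd hy.1 h

/-- Every step preserves the invariant and only extends the sliding registers. -/
theorem Inv.step {c c' : Config m n} {l : Lbl m n} (I : Inv c) (hs : Step c l c') :
    Inv c' ∧ Ext c.slr c'.slr ∧ c.M.widx ≤ c'.M.widx := by
  cases l with
  | invRead i =>
    obtain ⟨hpc, rfl⟩ := hs
    have R := I.r i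
    have hl := R.loc; rw [hpc] at hl
    refine ⟨I.upR i _ ⟨R.lo, R.hi, R.hh, R.mc, R.mcw, R.mem, ?_⟩ le_rfl, Ext.refl _, le_rfl⟩
    have nn := I.mok.nn
    split_ifs with h0
    · rcases hl with hl | hl
      · omega
      · exact hl
    · simp only [RLoc]; omega
  | respRead i v =>
    obtain ⟨hpc, -, rfl⟩ := hs
    have R := I.r i
    have hl := R.loc; rw [hpc] at hl
    exact ⟨I.upR i _ ⟨R.lo, R.hi, R.hh, R.mc, R.mcw, R.mem, .inr hl⟩ le_rfl, Ext.refl _, le_rfl⟩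
  | invWrite j v =>
    obtain ⟨hpc, rfl⟩ := hs
    have R := I.w j
    have hl := R.loc; rw [hpc] at hl
    exact ⟨I.upW j _ ⟨R.mc, R.mcw, R.help, hl⟩, Ext.refl _, le_rfl⟩
  | respWrite j =>
    obtain ⟨hpc, rfl⟩ := hs
    have R := I.w j
    have hl := R.loc; rw [hpc] at hl
    exact ⟨I.upW j _ ⟨R.mc, R.mcw, R.help, hl⟩, Ext.refl _, le_rfl⟩
  | invAudit a =>
    obtain ⟨hpc, rfl⟩ := hs
    exact ⟨⟨I.mok, I.nd, I.emp, I.u, I.r, I.w⟩, Ext.refl _, le_rfl⟩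
  | respAudit a A =>
    obtain ⟨hpc, -, rfl⟩ := hs
    exact ⟨⟨I.mok, I.nd, I.emp, I.u, I.r, I.w⟩, Ext.refl _, le_rfl⟩
  | slrRead p x win =>
    obtain ⟨hwin, hs⟩ := hs
    cases p with
    | rdr i =>
      have R := I.r i
      have hl := R.loc
      rcases hs with ⟨hpc, rfl, rfl⟩ | ⟨hpc, rfl, rfl⟩ | ⟨hpc, rfl, rfl⟩ | ⟨hpc, rfl, rfl⟩ <;>
        rw [hpc] at hl <;> subst hwin <;> refine ⟨?_, Ext.refl _, le_rfl⟩
      · refine I.upR i _ ⟨R.lo, R.hi, R.hh, R.mc, R.mcw, R.mem, ?_⟩ le_rfl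
        dsimp only
        split_ifs with h0
        · exact ⟨hl.1, hl.2, List.prefix_rfl, h0⟩
        · exact hl
      · exact I.upR i _ ⟨R.lo, R.hi, R.hh, R.mc, R.mcw, R.mem, ⟨hl.1, rfl, hl.2.2⟩⟩ le_rfl
      · exact I.upR i _ ⟨R.lo, R.hi, R.hh, R.mc, R.mcw, R.mem, ⟨hl.1, List.prefix_rfl, hl.2⟩⟩ le_rfl
      · exact I.upR i _ ⟨R.lo, R.hi, R.hh, R.mc, R.mcw, R.mem, ⟨hl.1, hl.2.1, hl.2.2, rfl⟩⟩ le_rfl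
    | wtr j =>
      have R := I.w j
      have hl := R.loc
      rcases hs with ⟨hpc, rfl, hk, rfl⟩ | ⟨hpc, rfl, rfl⟩ | ⟨hpc, rfl, rfl⟩ <;>
        rw [hpc] at hl <;> subst hwin <;> refine ⟨?_, Ext.refl _, le_rfl⟩
      · refine I.upW j _ ⟨R.mc, R.mcw, ?_, hl.1⟩
        intro i hi
        dsimp only at hi
        split_ifs at hi
        · exact R.help i hi
        · rcases Finset.mem_insert.1 hi with rfl | hi
          · exact hl.2 hk
          · exact R.help i hi
      · exact I.upW j _ ⟨R.mc, R.mcw, R.help, ⟨hl.1, hl.2, List.prefix_rfl⟩⟩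
      · exact I.upW j _ ⟨R.mc, R.mcw, R.help, ⟨hl.1, hl.2.1, hl.2.2, rfl⟩⟩
    | adt a =>
      rcases hs with ⟨hpc, rfl, rfl⟩ | ⟨hpc, rfl, rfl⟩
      · exact ⟨⟨I.mok, I.nd, I.emp, I.u, I.r, I.w⟩, Ext.refl _, le_rfl⟩
      · exact ⟨⟨I.mok, I.nd, I.emp, I.u, I.r, I.w⟩, Ext.refl _, le_rfl⟩
  | slrWrite p x e =>
    cases p with
    | rdr i =>
      obtain ⟨hpc, rfl, rfl, rfl⟩ := hs
      exact ⟨(I.slrR i hpc).2, (I.slrR i hpc).1, le_rfl⟩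
    | wtr j =>
      obtain ⟨hpc, rfl, rfl, rfl⟩ := hs
      exact ⟨(I.slrW j hpc).2, (I.slrW j hpc).1, le_rfl⟩
    | adt a => exact hs.elim
  | mRead p v =>
    obtain ⟨rfl, hs⟩ := hs
    cases p with
    | rdr i =>
      have R := I.r i
      have hl := R.loc
      have hi := R.hi
      have hlo := R.lo
      have hh := R.hh
      rcases hs with ⟨hpc, rfl⟩ | ⟨hpc, rfl⟩ <;>
        rw [hpc] at hl <;> refine ⟨?_, Ext.refl _, le_rfl⟩
      · refine I.upR i _ ⟨R.lo, R.hi, R.hh, I.mok, le_rfl, R.mem, ?_⟩ le_rfl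
        dsimp only
        split_ifs with h0
        · exact ⟨hl.1, hl.2.1, hl.2.2.1, hl.2.2.2, h0⟩
        · simp only [RLoc]; omega
      · simp only [RLoc] at hl
        split_ifs with h0
        · rcases I.mok.rx i with h1 | ⟨h1, h2, h3⟩
          · omega
          · exact I.upR i _ ⟨by dsimp only; omega, h2.le, by dsimp only; omega, I.mok, le_rfl,
              fun x hx => (R.mem x hx).trans h0.le, ⟨h1, h2, h3⟩⟩ h0.le
        · exact I.upR i _ ⟨by dsimp only; omega, le_rfl, by dsimp only; omega, I.mok, le_rfl,
              fun x hx => (R.mem x hx).trans hi, ⟨rfl, fun x hx => (R.mem x hx).trans_lt hl⟩⟩ hi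
    | wtr j =>
      obtain ⟨hpc, rfl⟩ := hs
      have R := I.w j
      have hl := R.loc; rw [hpc] at hl
      exact ⟨I.upW j _ ⟨I.mok, le_rfl, by simp, hl⟩, Ext.refl _, le_rfl⟩
    | adt a =>
      obtain ⟨hpc, rfl⟩ := hs
      exact ⟨⟨I.mok, I.nd, I.emp, I.u, I.r, I.w⟩, Ext.refl _, le_rfl⟩
  | mWrite p v =>
    cases p with
    | rdr i =>
      have R := I.r i
      have hl := R.loc
      rcases hs with ⟨hpc, hv, rfl⟩ | ⟨hpc, hw, hv, rfl⟩ <;>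
        rw [hpc] at hl <;> refine ⟨?_, Ext.refl _, wmax_le _ _⟩
      · obtain ⟨h0, hg, hp, hw, hm⟩ := hl
        have hok : MOK c.slr v := by
          rw [hv, hg.1, ← hm]
          exact R.mc.arg (hm ▸ hp) hw
        have I' := I.setM v hok
        have R' := I'.r i
        refine I'.upR i _ ⟨R'.lo, R'.hi, R'.hh, R'.mc, R'.mcw, R'.mem, ?_⟩ le_rfl
        have := wmax_le' c.M v
        have h2 : v.widx = (c.rst i).lsr + 1 := by rw [hv]; rfl
        simp only [RLoc]; omega
      · obtain ⟨hm, hp, hr, hg⟩ := hl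
        have hok : MOK c.slr v := by
          rw [hv, hg, ← hm]
          exact R.mc.arg (hm ▸ hp) hw
        have I' := I.setM v hok
        have R' := I'.r i
        refine I'.upR i _ ⟨R'.lo, R'.hi, R'.hh, R'.mc, R'.mcw, R'.mem, ?_⟩ le_rfl
        have := wmax_le' c.M v
        have h2 : v.widx = (c.rst i).lsr + 1 := by rw [hv]; rfl
        exact ⟨hm, hp, hr, hg, fun _ => by dsimp only; omega⟩
    | wtr j =>
      obtain ⟨hpc, hv, rfl⟩ := hs
      have R := I.w j
      have hl := R.loc; rw [hpc] at hl
      obtain ⟨hm, hw, hp, hg⟩ := hl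
      have hok : MOK c.slr v := by
        rw [hv, hg]
        exact R.mc.arg hp hw
      have I' := I.setM v hok
      have R' := I'.w j
      refine ⟨I'.upW j _ ⟨R'.mc, R'.mcw, R'.help, ?_⟩, Ext.refl _, wmax_le _ _⟩
      have := wmax_le' c.M v
      have h2 : v.widx = (c.wst j).mc.widx + 1 := by rw [hv]; rfl
      intro x v' h hx
      have := hm x v' h hx
      dsimp only; omega
    | adt a => exact hs.elim
  | hRead j k a =>
    obtain ⟨hpc, hk, rfl, rfl⟩ := hs
    have R := I.w j
    have hl := R.loc; rw [hpc] at hl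
    refine ⟨?_, Ext.refl _, le_rfl⟩
    split_ifs with h0
    · refine I.upW j _ ⟨R.mc, R.mcw, R.help, ⟨hl, ?_⟩⟩
      intro hk'
      have : (⟨(c.wst j).k, hk'⟩ : Fin m) = k := Fin.ext hk.symm
      dsimp only at hk' ⊢
      rw [this]
      exact h0.trans_le (I.r k).hh
    · refine I.upW j _ ⟨R.mc, R.mcw, R.help, ?_⟩
      dsimp only
      rw [hpc]; exact hl
  | hWrite i x =>
    obtain ⟨hpc, rfl, rfl⟩ := hs
    have I' := I.setH i
    have R' := I'.r i
    have hl := R'.loc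
    have hpc' : RState.pc ((({ c with H := Function.update c.H i (c.rst i).lsr } :
      Config m n)).rst i) = .annH := hpc
    rw [hpc'] at hl
    exact ⟨I'.upR i _ ⟨R'.lo, R'.hi, R'.hh, R'.mc, R'.mcw, R'.mem, hl⟩ le_rfl, Ext.refl _, le_rfl⟩
  | tau p =>
    cases p with
    | rdr i =>
      have R := I.r i
      have hl := R.loc
      rcases hs with ⟨hpc, hw, rfl⟩ | ⟨hpc, rfl⟩ <;>
        rw [hpc] at hl <;> refine ⟨?_, Ext.refl _, le_rfl⟩
      · exact I.upR i _ ⟨R.lo, R.hi, R.hh, R.mc, R.mcw, R.mem,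
          ⟨hl.1, hl.2.1, hl.2.2.1, hl.2.2.2, fun h => by dsimp only at h; simp [hw] at h⟩⟩ le_rfl
      · refine I.upR i _ ⟨R.lo, R.hi, R.hh, R.mc, R.mcw, R.mem, ?_⟩ le_rfl
        obtain ⟨hm, hp, hr, hg, hlt⟩ := hl
        have nn := R.mc.nn
        dsimp only
        split_ifs with h0
        · exact ⟨by dsimp only; omega, hg, readersOf_mono hp h0⟩
        · cases hw : hasW (c.rst i).win with
          | true => exact hlt hw
          | false => exact absurd (mem_readersOf hr hw) h0
    | wtr j =>
      obtain ⟨hpc, hk, rfl⟩ := hs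
      have R := I.w j
      have hl := R.loc; rw [hpc] at hl
      exact ⟨I.upW j _ ⟨R.mc, R.mcw, R.help, hl⟩, Ext.refl _, le_rfl⟩
    | adt a => exact hs.elim

/-! ### Traces -/

theorem rst_other {c c' : Config m n} {l : Lbl m n} (hs : Step c l c') {i : Fin m}
    (hp : procOf l ≠ .rdr i) : c'.rst i = c.rst i := by
  have key : ∀ k s, (Proc.rdr k : Proc m n) ≠ .rdr i → Function.update c.rst k s i = c.rst i := by
    intro k s h
    have : i ≠ k := fun e => h (by rw [e])
    simp [this]
  cases l with
  | invRead k => obtain ⟨-, rfl⟩ := hs; exact key _ _ hp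
  | respRead k v => obtain ⟨-, -, rfl⟩ := hs; exact key _ _ hp
  | invWrite j v => obtain ⟨-, rfl⟩ := hs; rfl
  | respWrite j => obtain ⟨-, rfl⟩ := hs; rfl
  | invAudit a => obtain ⟨-, rfl⟩ := hs; rfl
  | respAudit a A => obtain ⟨-, -, rfl⟩ := hs; rfl
  | slrRead p x win =>
    obtain ⟨-, hs⟩ := hs
    cases p with
    | rdr k =>
      rcases hs with ⟨-, -, rfl⟩ | ⟨-, -, rfl⟩ | ⟨-, -, rfl⟩ | ⟨-, -, rfl⟩ <;> exact key _ _ hp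
    | wtr j => rcases hs with ⟨-, -, -, rfl⟩ | ⟨-, -, rfl⟩ | ⟨-, -, rfl⟩ <;> rfl
    | adt a => rcases hs with ⟨-, -, rfl⟩ | ⟨-, -, rfl⟩ <;> rfl
  | slrWrite p x e =>
    cases p with
    | rdr k => obtain ⟨-, -, -, rfl⟩ := hs; exact key _ _ hp
    | wtr j => obtain ⟨-, -, -, rfl⟩ := hs; rfl
    | adt a => exact hs.elim
  | mRead p v =>
    obtain ⟨-, hs⟩ := hs
    cases p with
    | rdr k => rcases hs with ⟨-, rfl⟩ | ⟨-, rfl⟩ <;> exact key _ _ hp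
    | wtr j => obtain ⟨-, rfl⟩ := hs; rfl
    | adt a => obtain ⟨-, rfl⟩ := hs; rfl
  | mWrite p v =>
    cases p with
    | rdr k => rcases hs with ⟨-, -, rfl⟩ | ⟨-, -, -, rfl⟩ <;> exact key _ _ hp
    | wtr j => obtain ⟨-, -, rfl⟩ := hs; rfl
    | adt a => exact hs.elim
  | hRead j k a => obtain ⟨-, -, -, rfl⟩ := hs; rfl
  | hWrite k x => obtain ⟨-, -, rfl⟩ := hs; exact key _ _ hp
  | tau p =>
    cases p with
    | rdr k => rcases hs with ⟨-, -, rfl⟩ | ⟨-, rfl⟩ <;> exact key _ _ hp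
    | wtr j => obtain ⟨-, -, rfl⟩ := hs; rfl
    | adt a => exact hs.elim

theorem ast_other {c c' : Config m n} {l : Lbl m n} (hs : Step c l c') {i : ℕ}
    (hp : procOf l ≠ .adt i) : c'.ast i = c.ast i := by
  have key : ∀ k s, (Proc.adt k : Proc m n) ≠ .adt i → Function.update c.ast k s i = c.ast i := by
    intro k s h
    have : i ≠ k := fun e => h (by rw [e])
    simp [this]
  cases l with
  | invRead k => obtain ⟨-, rfl⟩ := hs; rfl
  | respRead k v => obtain ⟨-, -, rfl⟩ := hs; rfl
  | invWrite j v => obtain ⟨-, rfl⟩ := hs; rfl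
  | respWrite j => obtain ⟨-, rfl⟩ := hs; rfl
  | invAudit a => obtain ⟨-, rfl⟩ := hs; exact key _ _ hp
  | respAudit a A => obtain ⟨-, -, rfl⟩ := hs; exact key _ _ hp
  | slrRead p x win =>
    obtain ⟨-, hs⟩ := hs
    cases p with
    | rdr k =>
      rcases hs with ⟨-, -, rfl⟩ | ⟨-, -, rfl⟩ | ⟨-, -, rfl⟩ | ⟨-, -, rfl⟩ <;> rfl
    | wtr j => rcases hs with ⟨-, -, -, rfl⟩ | ⟨-, -, rfl⟩ | ⟨-, -, rfl⟩ <;> rfl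
    | adt a => rcases hs with ⟨-, -, rfl⟩ | ⟨-, -, rfl⟩ <;> exact key _ _ hp
  | slrWrite p x e =>
    cases p with
    | rdr k => obtain ⟨-, -, -, rfl⟩ := hs; rfl
    | wtr j => obtain ⟨-, -, -, rfl⟩ := hs; rfl
    | adt a => exact hs.elim
  | mRead p v =>
    obtain ⟨-, hs⟩ := hs
    cases p with
    | rdr k => rcases hs with ⟨-, rfl⟩ | ⟨-, rfl⟩ <;> rfl
    | wtr j => obtain ⟨-, rfl⟩ := hs; rfl
    | adt a => obtain ⟨-, rfl⟩ := hs; exact key _ _ hp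
  | mWrite p v =>
    cases p with
    | rdr k => rcases hs with ⟨-, -, rfl⟩ | ⟨-, -, -, rfl⟩ <;> rfl
    | wtr j => obtain ⟨-, -, rfl⟩ := hs; rfl
    | adt a => exact hs.elim
  | hRead j k a => obtain ⟨-, -, -, rfl⟩ := hs; rfl
  | hWrite k x => obtain ⟨-, -, rfl⟩ := hs; rfl
  | tau p =>
    cases p with
    | rdr k => rcases hs with ⟨-, -, rfl⟩ | ⟨-, rfl⟩ <;> rfl
    | wtr j => obtain ⟨-, -, rfl⟩ := hs; rfl
    | adt a => exact hs.elim

/-- No recording of `i` strictly between `x0` and `x`. -/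
def NoRec (S : ℤ → List (Entry m n)) (i : Fin m) (x0 x : ℤ) : Prop :=
  ∀ y, x0 < y → y < x → i ∉ readersOf (S y)

/-- History predicate of a pending READ of `i` that started with `lsr = x0`. -/
def QLoc (x0 : ℤ) (S : ℤ → List (Entry m n)) (s : RState m n) (i : Fin m) : RPC → Prop
  | .idle => False
  | .precheck => s.lsr = x0
  | .preM => s.lsr = x0
  | .preHelp => s.lsr = x0
  | .loopM => x0 ≤ s.lsr ∧ NoRec S i x0 (s.lsr + 1)
  | .retNow => s.lsr = x0 ∨ (x0 < s.lsr ∧ NoRec S i x0 s.lsr)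
  | _ => x0 < s.lsr ∧ NoRec S i x0 s.lsr

theorem NoRec.mono {S S' : ℤ → List (Entry m n)} {i : Fin m} {x0 x W : ℤ} (h : NoRec S i x0 x)
    (he : Ext S S') (h0 : -1 ≤ x0) (hx : x ≤ W)
    (hS : ∀ y, -1 ≤ y → y < W → hasW (S y) = true) : NoRec S' i x0 x := by
  intro y h1 h2
  rw [readersOf_prefix (he y) (hS y (by omega) (by omega))]
  exact h y h1 h2

theorem QLoc.mono {S S' : ℤ → List (Entry m n)} {i : Fin m} {x0 W H : ℤ} {s : RState m n}
    (h : QLoc x0 S s i s.pc) (R : RInv S W H s i)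
    (he : Ext S S') (h0 : -1 ≤ x0)
    (hS : ∀ y, -1 ≤ y → y < W → hasW (S y) = true) : QLoc x0 S' s i s.pc := by
  have hl := R.loc
  have hm : NoRec S i x0 s.lsr → NoRec S' i x0 s.lsr := fun h => h.mono he h0 R.hi hS
  cases hpc : s.pc <;> rw [hpc] at h hl <;> simp only [QLoc, RLoc] at h hl ⊢ <;>
    first
    | exact h
    | exact ⟨h.1, hm h.2⟩
    | exact h.imp id fun h => ⟨h.1, hm h.2⟩
    | exact ⟨h.1, h.2.mono he h0 (by omega) hS⟩

theorem QLoc.step {c c' : Config m n} {l : Lbl m n} (I : Inv c) (hs : Step c l c') {i : Fin m}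
    {x0 : ℤ} (h0 : -1 ≤ x0) (hq : QLoc x0 c.slr (c.rst i) i (c.rst i).pc)
    (hr : ¬ isRespOf l (.rdr i)) : QLoc x0 c'.slr (c'.rst i) i (c'.rst i).pc := by
  by_cases hp : procOf l = .rdr i
  swap
  · rw [rst_other hs hp]
    exact hq.mono (I.r i) (I.step hs).2.1 h0 I.mok.hw
  have he := (I.step hs).2.1
  have R := I.r i
  have hl := R.loc
  cases l with
  | invRead k =>
    simp only [procOf, Proc.rdr.injEq] at hp; subst hp
    obtain ⟨hpc, rfl⟩ := hs
    rw [hpc] at hq; exact hq.elim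
  | respRead k v =>
    simp only [procOf, Proc.rdr.injEq] at hp; subst hp
    exact absurd (.inl ⟨_, _, rfl, rfl⟩) hr
  | invWrite j v => simp [procOf] at hp
  | respWrite j => simp [procOf] at hp
  | invAudit a => simp [procOf] at hp
  | respAudit a A => simp [procOf] at hp
  | hRead j k a => simp [procOf] at hp
  | hWrite k x =>
    simp only [procOf, Proc.rdr.injEq] at hp; subst hp
    obtain ⟨hpc, -, rfl⟩ := hs
    rw [hpc] at hq
    simp only [upR, Function.update_self]
    exact hq
  | slrRead p x win =>
    simp only [procOf] at hp; subst hp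
    obtain ⟨-, hs⟩ := hs
    rcases hs with ⟨hpc, rfl, rfl⟩ | ⟨hpc, rfl, rfl⟩ | ⟨hpc, rfl, rfl⟩ | ⟨hpc, rfl, rfl⟩ <;>
      rw [hpc] at hq <;> simp only [upR, Function.update_self]
    · split_ifs
      · exact hq
      · exact .inl hq
    · exact .inr hq
    · exact hq
    · exact hq
  | slrWrite p x e =>
    simp only [procOf] at hp; subst hp
    obtain ⟨hpc, rfl, rfl, rfl⟩ := hs
    rw [hpc] at hq
    have hm : NoRec _ i x0 (c.rst i).lsr := hq.2.mono he h0 R.hi I.mok.hw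
    simp only [upR, Function.update_self]
    exact ⟨hq.1, hm⟩
  | mRead p v =>
    simp only [procOf] at hp; subst hp
    obtain ⟨rfl, hs⟩ := hs
    rcases hs with ⟨hpc, rfl⟩ | ⟨hpc, rfl⟩ <;>
      rw [hpc] at hq hl <;> simp only [upR, Function.update_self]
    · simp only [QLoc] at hq
      split_ifs
      · exact hq
      · refine ⟨hq.ge, ?_⟩
        intro y h1 h2
        dsimp only at h2; omega
    · simp only [QLoc, RLoc] at hq hl
      split_ifs with h1
      · refine ⟨by dsimp only; omega, ?_⟩
        intro y h2 h3 h4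
        dsimp only at h3
        rcases I.mok.rx i with h5 | ⟨h5, h6, h7⟩
        · omega
        · have := I.u i y _ (by omega) h3 h4 h7
          exact hq.2 y h2 (by omega) h4
      · refine ⟨by dsimp only; omega, ?_⟩
        intro y h2 h3 h4
        dsimp only at h3
        have := (I.mok.rc i y (by omega) h3 h4).1
        exact hq.2 y h2 (by omega) h4
  | mWrite p v =>
    simp only [procOf] at hp; subst hp
    rcases hs with ⟨hpc, hv, rfl⟩ | ⟨hpc, hw, hv, rfl⟩ <;>
      rw [hpc] at hq <;> simp only [upR, Function.update_self]
    · simp only [QLoc] at hq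
      refine ⟨hq.ge, ?_⟩
      intro y h1 h2
      dsimp only at h2; omega
    · exact hq
  | tau p =>
    simp only [procOf] at hp; subst hp
    rcases hs with ⟨hpc, hw, rfl⟩ | ⟨hpc, rfl⟩ <;>
      rw [hpc] at hq hl <;> simp only [upR, Function.update_self]
    · exact hq
    · split_ifs with h1
      · exact .inr hq
      · obtain ⟨hm, hp, hr, hg, hlt⟩ := hl
        refine ⟨hq.1.le, ?_⟩
        intro y h2 h3
        dsimp only at h3
        by_cases hy : y = (c.rst i).lsr
        · subst hy
          have hw : hasW (c.rst i).win = true := by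
            cases hw : hasW (c.rst i).win with
            | true => rfl
            | false => exact absurd (mem_readersOf hr hw) h1
          rw [readersOf_prefix hp hw]; exact h1
        · exact hq.2 y h2 (by omega)

theorem inv_all (E : Exec m n v0 j0) : ∀ t, t ≤ E.len → Inv (E.cfg t) := by
  intro t
  induction t with
  | zero => intro _; rw [E.h0]; exact inv_init
  | succ t ih => intro h; exact ((ih (by omega)).step (E.hstep t (by omega))).1

theorem ext_all (E : Exec m n v0 j0) {t t' : ℕ} (h : t ≤ t') (h' : t' ≤ E.len) :
    Ext (E.cfg t).slr (E.cfg t').slr := by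
  induction t', h using Nat.le_induction with
  | base => exact Ext.refl _
  | succ k hk ih =>
    intro y
    exact (ih (by omega) y).trans
      (((inv_all E k (by omega)).step (E.hstep k (by omega))).2.1 y)

/-- A complete READ returns the value of `SLR[x-1]` for an `x` where it is recorded. -/
theorem read_result (E : Exec m n v0 j0) {i : Fin m} {a b : ℕ} {v : Val}
    (ha : E.lbl a = .invRead i) (hm : RespMatch E (.rdr i) a (some b))
    (hb : E.lbl b = .respRead i v) :
    ∃ x, 0 ≤ x ∧ v = wval ((E.cfg E.len).slr (x - 1)) ∧ i ∈ readersOf ((E.cfg E.len).slr x) ∧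
      (x = ((E.cfg a).rst i).lsr ∨
        (((E.cfg a).rst i).lsr < x ∧ NoRec (E.cfg E.len).slr i ((E.cfg a).rst i).lsr x)) := by
  obtain ⟨hab, hbl, -, hno⟩ := hm
  set x0 := ((E.cfg a).rst i).lsr with hx0
  have h0 : -1 ≤ x0 := ((inv_all E a (by omega)).r i).lo
  have hQ : ∀ t, a + 1 ≤ t → t ≤ b →
      QLoc x0 (E.cfg t).slr ((E.cfg t).rst i) i ((E.cfg t).rst i).pc := by
    intro t ht
    induction t, ht using Nat.le_induction with
    | base =>
      intro _
      have hs := E.hstep a (by omega)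
      rw [ha] at hs
      obtain ⟨-, hs⟩ := hs
      rw [hs]
      simp only [upR, Function.update_self]
      split_ifs
      · exact rfl
      · refine ⟨le_rfl, ?_⟩
        intro y h1 h2
        dsimp only at h2; omega
    | succ k hk ih =>
      intro hkb
      exact QLoc.step (inv_all E k (by omega)) (E.hstep k (by omega)) h0 (ih (by omega))
        (hno k (by omega) (by omega))
  have hq := hQ b (by omega) le_rfl
  have Ib := inv_all E b (by omega)
  have R := Ib.r i
  have hl := R.loc
  have hs := E.hstep b hbl
  rw [hb] at hs
  obtain ⟨hpc, hv, -⟩ := hs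
  rw [hpc] at hq hl
  have he := ext_all E hbl.le le_rfl
  have hhi := R.hi
  have hl0 := hl.1
  refine ⟨((E.cfg b).rst i).lsr, hl.1, ?_, readersOf_mono (he _) hl.2.2, ?_⟩
  · rw [wval_prefix (he _) (Ib.mok.hw _ (by omega) (by omega)), hv]
    exact hl.2.1
  · exact hq.imp id fun h => ⟨h.1, h.2.mono he h0 hhi Ib.mok.hw⟩

/-- A silent READ returns the value of `SLR[idx-1]`, and is recorded in `SLR[idx]`
    when it reads it. -/
theorem silent_result (E : Exec m n v0 j0) {i : Fin m} {a b k : ℕ} {v : Val} {x : ℤ}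
    {win : List (Entry m n)}
    (hm : RespMatch E (.rdr i) a (some b))
    (hak : a < k) (hkb : k < b)
    (hk : E.lbl k = .slrRead (.rdr i) x win) (hpc : ((E.cfg k).rst i).pc = .precheck)
    (hw : hasW win = false)
    (hb : E.lbl b = .respRead i v) :
    0 ≤ x ∧ v = wval ((E.cfg E.len).slr (x - 1)) ∧ i ∈ readersOf ((E.cfg k).slr x) := by
  obtain ⟨hab, hbl, -, hno⟩ := hm
  have Ik := inv_all E k (by omega)
  have hl := (Ik.r i).loc
  rw [hpc] at hl
  have hs := E.hstep k (by omega)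
  rw [hk] at hs
  obtain ⟨-, hs⟩ := hs
  simp only [hpc, reduceCtorEq, false_and, or_false, true_and] at hs
  obtain ⟨hx, hs⟩ := hs
  have hQ : ∀ t, k + 1 ≤ t → t ≤ b →
      ((E.cfg t).rst i).pc = .retNow ∧ ((E.cfg t).rst i).lsr = x ∧
        ((E.cfg t).rst i).lval = ((E.cfg k).rst i).lval := by
    intro t ht
    induction t, ht using Nat.le_induction with
    | base =>
      intro _
      rw [hs]
      simp [upR, hw, hx]
    | succ t ht ih =>
      intro htb
      obtain ⟨h1, h2, h3⟩ := ih (by omega)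
      have hst := E.hstep t (by omega)
      by_cases hp : procOf (E.lbl t) = .rdr i
      swap
      · rw [rst_other hst hp]; exact ⟨h1, h2, h3⟩
      exfalso
      have hr := hno t (by omega) (by omega)
      cases hlb : E.lbl t with
      | respRead k' v' =>
        rw [hlb] at hr hp
        simp only [procOf, Proc.rdr.injEq] at hp; subst hp
        exact hr (.inl ⟨_, _, rfl, rfl⟩)
      | invRead k' =>
        rw [hlb] at hst hp
        simp only [procOf, Proc.rdr.injEq] at hp; subst hp
        obtain ⟨hpc', -⟩ := hst
        rw [h1] at hpc'; cases hpc'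
      | hWrite k' x' =>
        rw [hlb] at hst hp
        simp only [procOf, Proc.rdr.injEq] at hp; subst hp
        obtain ⟨hpc', -⟩ := hst
        rw [h1] at hpc'; cases hpc'
      | invWrite j v => rw [hlb] at hp; simp [procOf] at hp
      | respWrite j => rw [hlb] at hp; simp [procOf] at hp
      | invAudit a => rw [hlb] at hp; simp [procOf] at hp
      | respAudit a A => rw [hlb] at hp; simp [procOf] at hp
      | hRead j k a => rw [hlb] at hp; simp [procOf] at hp
      | slrRead p _ _ => rw [hlb] at hst hp; simp only [procOf] at hp; subst hp; simp [Step, h1] at hst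
      | slrWrite p _ _ => rw [hlb] at hst hp; simp only [procOf] at hp; subst hp; simp [Step, h1] at hst
      | mRead p _ => rw [hlb] at hst hp; simp only [procOf] at hp; subst hp; simp [Step, h1] at hst
      | mWrite p _ => rw [hlb] at hst hp; simp only [procOf] at hp; subst hp; simp [Step, h1] at hst
      | tau p => rw [hlb] at hst hp; simp only [procOf] at hp; subst hp; simp [Step, h1] at hst
  obtain ⟨h1, h2, h3⟩ := hQ b (by omega) le_rfl
  have hsb := E.hstep b hbl
  rw [hb] at hsb
  obtain ⟨-, hv, -⟩ := hsb
  have hhi := (Ik.r i).hi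
  obtain ⟨hl0, hl1, hl2⟩ := hl
  subst hx
  refine ⟨hl0, ?_, hl2⟩
  rw [wval_prefix (ext_all E (by omega : k ≤ E.len) le_rfl _)
    (Ik.mok.hw _ (by omega) (by omega)), hv, h3]
  exact hl1

/-- The outcome of an AUDIT. -/
theorem audit_result (E : Exec m n v0 j0) {a inv b tM k : ℕ} {mv : MVal m}
    {win : List (Entry m n)} {A : Finset (Fin m × Val)}
    (hm : RespMatch E (.adt a) inv (some b))
    (h1 : inv < tM) (h2 : tM < k) (h3 : k < b)
    (hM : E.lbl tM = .mRead (.adt a) mv)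
    (hk : E.lbl k = .slrRead (.adt a) mv.widx win)
    (hpk : ((E.cfg k).ast a).pc = .aR)
    (hb : E.lbl b = .respAudit a A) :
    MOK (E.cfg E.len).slr mv ∧ win = (E.cfg k).slr mv.widx ∧
      A = mv.aud ∪ (readersOf win).image
        (fun j => (j, wval ((E.cfg E.len).slr (mv.widx - 1)))) := by
  obtain ⟨hab, hbl, -, hno⟩ := hm
  have hsM := E.hstep tM (by omega)
  rw [hM] at hsM
  obtain ⟨hmv, hpM, hsM⟩ := hsM
  have hok : ∀ t, tM ≤ t → t ≤ E.len → MOK (E.cfg t).slr mv := by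
    intro t ht htl
    have := (inv_all E tM (by omega)).mok
    rw [← hmv] at this
    exact this.mono (ext_all E ht htl)
  have nn := (hok tM le_rfl (by omega)).nn
  have hQ1 : ∀ t, tM + 1 ≤ t → t ≤ b → ((E.cfg t).ast a).mc = mv ∧
      (((E.cfg t).ast a).pc = .aR ∨ ((E.cfg t).ast a).pc = .aV ∨ ((E.cfg t).ast a).pc = .aret) := by
    intro t ht
    induction t, ht using Nat.le_induction with
    | base => intro _; rw [hsM]; simp [upA]
    | succ t ht ih =>
      intro htb
      obtain ⟨g1, g2⟩ := ih (by omega)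
      have hs := E.hstep t (by omega)
      by_cases hp : procOf (E.lbl t) = .adt a
      swap
      · rw [ast_other hs hp]; exact ⟨g1, g2⟩
      have hr := hno t (by omega) (by omega)
      cases hlb : E.lbl t with
      | respAudit k' v' =>
        rw [hlb] at hr hp
        simp only [procOf, Proc.adt.injEq] at hp; subst hp
        exact absurd (.inr (.inr ⟨_, _, rfl, rfl⟩)) hr
      | invAudit k' =>
        rw [hlb] at hs hp
        simp only [procOf, Proc.adt.injEq] at hp; subst hp
        obtain ⟨hpc, -⟩ := hs
        simp [hpc] at g2
      | slrRead p _ _ =>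
        rw [hlb] at hs hp; simp only [procOf] at hp; subst hp
        obtain ⟨-, hs⟩ := hs
        rcases hs with ⟨-, -, hs⟩ | ⟨-, -, hs⟩ <;> rw [hs] <;> simp [upA, g1]
      | mRead p _ =>
        rw [hlb] at hs hp; simp only [procOf] at hp; subst hp
        obtain ⟨-, hpc, -⟩ := hs
        simp [hpc] at g2
      | slrWrite p _ _ => rw [hlb] at hs hp; simp only [procOf] at hp; subst hp; exact hs.elim
      | mWrite p _ => rw [hlb] at hs hp; simp only [procOf] at hp; subst hp; exact hs.elim
      | tau p => rw [hlb] at hs hp; simp only [procOf] at hp; subst hp; exact hs.elim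
      | invRead k' => rw [hlb] at hp; simp [procOf] at hp
      | respRead k' v' => rw [hlb] at hp; simp [procOf] at hp
      | hWrite k' x' => rw [hlb] at hp; simp [procOf] at hp
      | invWrite j v => rw [hlb] at hp; simp [procOf] at hp
      | respWrite j => rw [hlb] at hp; simp [procOf] at hp
      | hRead j k a => rw [hlb] at hp; simp [procOf] at hp
  have hsk := E.hstep k (by omega)
  rw [hk] at hsk
  obtain ⟨hwin, hsk⟩ := hsk
  simp only [hpk, reduceCtorEq, false_and, or_false, true_and] at hsk
  obtain ⟨-, hsk⟩ := hsk
  have hQ2 : ∀ t, k + 1 ≤ t → t ≤ b → ((E.cfg t).ast a).win = win ∧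
      (((E.cfg t).ast a).pc = .aV ∨ (((E.cfg t).ast a).pc = .aret ∧
        ((E.cfg t).ast a).val = wval ((E.cfg t).slr (mv.widx - 1)))) := by
    intro t ht
    induction t, ht using Nat.le_induction with
    | base => intro _; rw [hsk]; simp [upA]
    | succ t ht ih =>
      intro htb
      obtain ⟨g1, g2⟩ := ih (by omega)
      have g3 := (hQ1 t (by omega) (by omega)).1
      have hs := E.hstep t (by omega)
      have hv : wval ((E.cfg (t + 1)).slr (mv.widx - 1)) = wval ((E.cfg t).slr (mv.widx - 1)) :=
        wval_prefix (ext_all E (by omega) (by omega) _)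
          ((hok t (by omega) (by omega)).hw _ (by omega) (by omega))
      by_cases hp : procOf (E.lbl t) = .adt a
      swap
      · rw [ast_other hs hp, hv]; exact ⟨g1, g2⟩
      have hr := hno t (by omega) (by omega)
      cases hlb : E.lbl t with
      | respAudit k' v' =>
        rw [hlb] at hr hp
        simp only [procOf, Proc.adt.injEq] at hp; subst hp
        exact absurd (.inr (.inr ⟨_, _, rfl, rfl⟩)) hr
      | invAudit k' =>
        rw [hlb] at hs hp
        simp only [procOf, Proc.adt.injEq] at hp; subst hp
        obtain ⟨hpc, -⟩ := hs
        simp [hpc] at g2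
      | slrRead p _ _ =>
        rw [hlb] at hs hp; simp only [procOf] at hp; subst hp
        obtain ⟨hw, hs⟩ := hs
        rcases hs with ⟨hpc, -, hs⟩ | ⟨hpc, hx, hs⟩
        · simp [hpc] at g2
        · rw [hv, hs]
          simp [upA, g1, hw, hx, g3]
      | mRead p _ =>
        rw [hlb] at hs hp; simp only [procOf] at hp; subst hp
        obtain ⟨-, hpc, -⟩ := hs
        simp [hpc] at g2
      | slrWrite p _ _ => rw [hlb] at hs hp; simp only [procOf] at hp; subst hp; exact hs.elim
      | mWrite p _ => rw [hlb] at hs hp; simp only [procOf] at hp; subst hp; exact hs.elim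
      | tau p => rw [hlb] at hs hp; simp only [procOf] at hp; subst hp; exact hs.elim
      | invRead k' => rw [hlb] at hp; simp [procOf] at hp
      | respRead k' v' => rw [hlb] at hp; simp [procOf] at hp
      | hWrite k' x' => rw [hlb] at hp; simp [procOf] at hp
      | invWrite j v => rw [hlb] at hp; simp [procOf] at hp
      | respWrite j => rw [hlb] at hp; simp [procOf] at hp
      | hRead j k a => rw [hlb] at hp; simp [procOf] at hp
  have hsb := E.hstep b hbl
  rw [hb] at hsb
  obtain ⟨hpb, hA, -⟩ := hsb
  obtain ⟨g1, -⟩ := hQ1 b (by omega) le_rfl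
  obtain ⟨g2, g3⟩ := hQ2 b (by omega) le_rfl
  simp only [hpb, reduceCtorEq, false_or, true_and] at g3
  refine ⟨hok _ (by omega) le_rfl, hwin, ?_⟩
  rw [hA, g1, g2, g3, wval_prefix (ext_all E hbl.le le_rfl _)
    ((hok b (by omega) (by omega)).hw _ (by omega) (by omega))]

/-- Uniform description of classified AUDITs. -/
theorem audit_op (E : Exec m n v0 j0) {o : OpData m n} (h : IsOp E o) (hk : o.kind.isAudit) :
    ∃ a mv win, MOK (E.cfg E.len).slr mv ∧ o.idx = mv.widx ∧ o.key < E.len ∧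
      E.lbl o.key = .slrRead (.adt a) o.idx win ∧
      win = (E.cfg o.key).slr o.idx ∧
      ((o.kind = .defA ∧ hasW win = true) ∨ (o.kind = .nondefA ∧ hasW win = false)) ∧
      o.aset = mv.aud ∪ (readersOf win).image
        (fun j => (j, wval ((E.cfg E.len).slr (o.idx - 1)))) := by
  obtain ⟨hinv, hm, h⟩ := h
  cases hkd : o.kind <;> rw [hkd] at h hk <;> simp only [Kind.isAudit] at hk
  · obtain ⟨a, b, tM, mv, win, hp, hr, h1, h2, h3, h4, h5, h6, h7, h8, h9, h10, h11, h12⟩ := h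
    rw [hp, hr] at hm
    have hbl : b < E.len := hm.2.1
    obtain ⟨g1, g2, g3⟩ := audit_result E hm h2 h3 h4 h5 (h7 ▸ h8) h9 h11
    exact ⟨a, mv, win, g1, h7, by omega, h8, h7 ▸ g2, .inl ⟨rfl, h10⟩, h7 ▸ g3⟩
  · obtain ⟨a, b, tM, mv, win, hp, hr, h1, h2, h3, h4, h5, h6, h7, h8, h9, h10, h11, h12⟩ := h
    rw [hp, hr] at hm
    have hbl : b < E.len := hm.2.1
    obtain ⟨g1, g2, g3⟩ := audit_result E hm h2 h3 h4 h5 (h7 ▸ h8) h9 h11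
    exact ⟨a, mv, win, g1, h7, by omega, h8, h7 ▸ g2, .inr ⟨rfl, h10⟩, h7 ▸ g3⟩

/-- The recorded index of a direct or helped READ. -/
theorem rec_op (E : Exec m n v0 j0) {o : OpData m n} {i : Fin m}
    (hp : o.proc = .rdr i) (hl : o.inv < E.len) (hm : RespMatch E o.proc o.inv o.resp)
    (ha : E.lbl o.inv = .invRead i)
    (hmin : minRecIdx E i ((E.cfg o.inv).rst i).lsr o.idx) (hv : ReadValOK E o i) :
    ∃ x, 0 ≤ x ∧ x ≤ o.idx ∧ o.val = wval ((E.cfg E.len).slr (x - 1)) ∧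
      i ∈ readersOf ((E.cfg E.len).slr x) := by
  obtain ⟨h1, h2, h3⟩ := hmin
  have hlo := ((inv_all E o.inv hl.le).r i).lo
  unfold ReadValOK at hv
  cases hr : o.resp with
  | none =>
    rw [hr] at hv
    exact ⟨o.idx, by omega, le_rfl, hv, h2⟩
  | some b =>
    rw [hr] at hv
    rw [hp, hr] at hm
    obtain ⟨x, g1, g2, g3, g4⟩ := read_result E ha hm hv
    refine ⟨x, g1, ?_, g2, g3⟩
    rcases g4 with g4 | ⟨g4, g5⟩
    · omega
    · by_contra hlt
      exact g5 o.idx h1 (by omega) h2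

/-- Uniform description of classified READs: either the READ is recorded at its index, possibly
    at an earlier one; silent and direct READs are recorded by the end of their key step. -/
theorem read_op (E : Exec m n v0 j0) {o : OpData m n} (h : IsOp E o) (hk : o.kind.isRead)
    {i : Fin m} (hp : o.proc = .rdr i) :
    (∃ x, 0 ≤ x ∧ x ≤ o.idx ∧ o.val = wval ((E.cfg E.len).slr (x - 1)) ∧
      i ∈ readersOf ((E.cfg E.len).slr x)) ∧
    (o.kind = .helpedR ∨
      (rank o.kind = 0 ∧ procOf (E.lbl o.key) = .rdr i ∧
        ∀ t, o.key < t → t ≤ E.len → hasW ((E.cfg t).slr o.idx) = false →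
          i ∈ readersOf ((E.cfg t).slr o.idx))) := by
  obtain ⟨hinv, hm, h⟩ := h
  cases hkd : o.kind <;> rw [hkd] at h hk <;> simp only [Kind.isRead] at hk
  · obtain ⟨i', b, win, hp', hr, h1, -, h2, h3, h4, h5, h6, h7, h8, -⟩ := h
    rw [hp] at hp'
    simp only [Proc.rdr.injEq] at hp'; subst hp'
    rw [hp, hr] at hm
    have hbl : b < E.len := hm.2.1
    obtain ⟨g1, g2, g3⟩ := silent_result E hm h3 h4 h5 h6 h7 h8
    refine ⟨⟨o.idx, g1, le_rfl, g2, readersOf_mono (ext_all E (by omega) le_rfl _) g3⟩,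
      .inr ⟨rfl, by rw [h5]; rfl, ?_⟩⟩
    intro t ht htl _
    exact readersOf_mono (ext_all E ht.le htl _) g3
  · obtain ⟨i', hp', h1, h2, h3, h4, h5, h6, h7, h8, -⟩ := h
    rw [hp] at hp'
    simp only [Proc.rdr.injEq] at hp'; subst hp'
    refine ⟨rec_op E hp hinv hm h1 h2 h8, .inr ⟨rfl, by rw [h6]; rfl, ?_⟩⟩
    intro t ht htl hw
    have hs := E.hstep o.key h5
    have Ik := inv_all E o.key h5.le
    have I' := (Ik.step hs).1
    rw [h6] at hs
    obtain ⟨hpc, hx, -, hs⟩ := hs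
    have hl := (I'.r i).loc
    have hpc' : ((E.cfg (o.key + 1)).rst i).pc = .rSLR := by rw [hs]; simp [upR]
    have hlsr : ((E.cfg (o.key + 1)).rst i).lsr = o.idx := by rw [hs, hx]; simp [upR]
    rw [hpc'] at hl
    have hmem := hl.2
    rw [hlsr] at hmem
    exact mem_readersOf ((ext_all E (by omega : o.key + 1 ≤ t) htl _).subset hmem) hw
  · obtain ⟨i', hp', h1, h2, h3, h4, h5, -⟩ := h
    rw [hp] at hp'
    simp only [Proc.rdr.injEq] at hp'; subst hp'
    exact ⟨rec_op E hp hinv hm h1 h2 h5, .inl rfl⟩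

/-- Lemma `adt_complete`.  The AUDIT operations are
complete: if an AUDIT operation `aop` returns the set `A`, and a READ
operation `rop` by reader `p_j` returning the value `v` precedes `aop` in the
linearization `λ` (any order satisfying rules `R0`–`R4`, formalized by
`LinOK`), then `(j, v) ∈ A`. -/
theorem audit_complete (m n : ℕ) (v0 : Val) (j0 : Fin n) (E : Exec m n v0 j0)
    (lt : OpData m n → OpData m n → Prop) (hlin : LinOK E lt)
    (aop rop : OpData m n) (ha : IsOp E aop) (hak : aop.kind.isAudit)
    (hr : IsOp E rop) (hrk : rop.kind.isRead)
    (j : Fin m) (hj : rop.proc = .rdr j)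
    (hord : lt rop aop) :
    (j, rop.val) ∈ aop.aset := by
  obtain ⟨hirr, htr, -, hR0, hR1, hR2⟩ := hlin
  have hnot : ¬ lt aop rop := fun h => hirr rop hr (htr rop aop rop hr ha hr hord h)
  obtain ⟨⟨x, hx0, hxi, hv, hrec⟩, hkind⟩ := read_op E hr hrk hj
  obtain ⟨a, mv, win, hok, hidx, hkey, hlbl, hwin, hak', hA⟩ := audit_op E ha hak
  have hle : rop.idx ≤ aop.idx := by
    by_contra hlt
    exact hnot (hR0 aop rop ha hr (by omega))
  rw [hA]
  by_cases hx : x < mv.widx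
  · rw [hv]
    exact Finset.mem_union_left _ (hok.rc j x hx0 hx hrec).2
  have hxe : x = aop.idx := by omega
  have hie : aop.idx = rop.idx := by omega
  subst hxe
  have he := ext_all E hkey.le le_rfl aop.idx
  rw [← hwin] at he
  have hfin : j ∈ readersOf win := by
    rcases hak' with ⟨-, hw⟩ | ⟨hkd, hw⟩
    · rwa [readersOf_prefix he hw] at hrec
    · rcases hkind with hk | ⟨hk, hp, hk'⟩
      · exact absurd (hR1 aop rop ha hr hie (by rw [hkd, hk]; decide)) hnot
      · have h1 : ¬ aop.key < rop.key := fun h =>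
          hnot (hR2 aop rop ha hr hie (by rw [hkd, hk]; rfl) (by rw [hkd]; decide) h)
        have h2 : rop.key ≠ aop.key := by
          intro h
          rw [h, hlbl] at hp
          simp [procOf] at hp
        have := hk' aop.key (by omega) hkey.le
        rw [← hie, ← hwin] at this
        exact this hw
  rw [hv]
  exact Finset.mem_union_right _ (Finset.mem_image_of_mem _ hfin)

end Alg1
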